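/- arXiv:2412.13603 — 3 statements merged into one kernel-verified Lean document; each statement's English description precedes it below -/
import Mathlib

section
/- Let φ be an even nonconstant polynomial with positive leading coefficient, ρ = e^{-φ}, and (P̃_n) the orthonormal polynomials for ρ with recursion coefficients a_n. For every n ≥ 1, P̃_n satisfies the differential equation P̃_n'(x) + B_n(x) P̃_n(x) = A_n(x) P̃_{n-1}(x) for all x ∈ ℝ, where A_n(x) = a_n ∫_ℝ D(x,y) P̃_n(y)² ρ(y) dy and B_n(x) = a_n ∫_ℝ D(x,y) P̃_n(y) P̃_{n-1}(y) ρ(y) dy, and D(x,y) is the two-variable polynomial with D(x,y)(x−y) = φ'(x) − φ'(y) (the divided difference of φ'). In particular A_n and B_n are polynomial functions of x. -/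
open MeasureTheory Polynomial

namespace OrthonormalPolynomials

/-! Algebraic facts about polynomials orthonormal for a linear functional. -/

section Algebra

variable {L : ℝ[X] →ₗ[ℝ] ℝ} {P : ℕ → ℝ[X]}

theorem exists_eq_sum_of_degree_lt (hdeg : ∀ n, (P n).natDegree = n) (hP : ∀ n, P n ≠ 0)
    (N : ℕ) (q : ℝ[X]) (hq : q.degree < N) :
    ∃ c : ℕ → ℝ, q = ∑ k ∈ Finset.range N, C (c k) * P k := by
  induction N generalizing q with
  | zero =>
    refine ⟨0, ?_⟩
    simpa using hq
  | succ N ih =>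
    have hlead : (P N).coeff N ≠ 0 := by
      have := leadingCoeff_ne_zero.mpr (hP N)
      rwa [leadingCoeff, hdeg N] at this
    obtain ⟨c, hc⟩ := ih (q - C (q.coeff N / (P N).coeff N) * P N) (by
      rw [degree_lt_iff_coeff_zero] at hq ⊢
      intro m hm
      rw [coeff_sub, coeff_C_mul]
      rcases hm.eq_or_lt with rfl | hlt
      · field_simp
        ring
      · rw [hq m hlt, coeff_eq_zero_of_natDegree_lt ((hdeg N).trans_lt hlt)]
        simp)
    refine ⟨fun k => if k = N then q.coeff N / (P N).coeff N else c k, ?_⟩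
    simp only [Finset.sum_range_succ, if_true]
    have : ∑ k ∈ Finset.range N,
        C (if k = N then q.coeff N / (P N).coeff N else c k) * P k
        = ∑ k ∈ Finset.range N, C (c k) * P k :=
      Finset.sum_congr rfl fun k hk => by rw [if_neg (Finset.mem_range.mp hk).ne]
    rw [this, ← hc]
    ring

theorem map_C_mul (c : ℝ) (q : ℝ[X]) : L (C c * q) = c * L q := by
  rw [← smul_eq_C_mul, map_smul, smul_eq_mul]

theorem eq_sum_of_degree_lt (hdeg : ∀ n, (P n).natDegree = n) (hP : ∀ n, P n ≠ 0)
    (horth : ∀ i j, L (P i * P j) = if i = j then 1 else 0)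
    {N : ℕ} {q : ℝ[X]} (hq : q.degree < N) :
    q = ∑ k ∈ Finset.range N, C (L (q * P k)) * P k := by
  obtain ⟨c, hc⟩ := exists_eq_sum_of_degree_lt hdeg hP N q hq
  conv_lhs => rw [hc]
  refine Finset.sum_congr rfl fun k hk => ?_
  have : L (q * P k) = c k := by
    rw [hc, Finset.sum_mul, map_sum]
    simp_rw [mul_assoc, map_C_mul, horth]
    simp [Finset.mem_range.mp hk]
  rw [this]

theorem map_mul_eq_zero (hdeg : ∀ n, (P n).natDegree = n) (hP : ∀ n, P n ≠ 0)
    (horth : ∀ i j, L (P i * P j) = if i = j then 1 else 0)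
    {n : ℕ} {q : ℝ[X]} (hq : q.degree < n) : L (P n * q) = 0 := by
  rw [eq_sum_of_degree_lt hdeg hP horth hq, Finset.mul_sum, map_sum]
  refine Finset.sum_eq_zero fun k hk => ?_
  rw [mul_left_comm, map_C_mul, horth, if_neg (Finset.mem_range.mp hk).ne', mul_zero]

theorem degree_eq (hdeg : ∀ n, (P n).natDegree = n) (hP : ∀ n, P n ≠ 0) (n : ℕ) :
    (P n).degree = n := by
  rw [degree_eq_natDegree (hP n), hdeg]

theorem map_X_mul_mul_eq_zero (hdeg : ∀ n, (P n).natDegree = n) (hP : ∀ n, P n ≠ 0)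
    (horth : ∀ i j, L (P i * P j) = if i = j then 1 else 0)
    {n k : ℕ} (hk : k + 1 < n) : L (X * P n * P k) = 0 := by
  rw [show X * P n * P k = P n * (X * P k) by ring]
  refine map_mul_eq_zero hdeg hP horth ?_
  rw [degree_mul, degree_X, degree_eq hdeg hP]
  exact_mod_cast (by omega : 1 + k < n)

theorem X_mul_zero_eq (hdeg : ∀ n, (P n).natDegree = n) (hP : ∀ n, P n ≠ 0)
    (horth : ∀ i j, L (P i * P j) = if i = j then 1 else 0) :
    X * P 0 = C (L (X * P 0 * P 0)) * P 0 + C (L (X * P 0 * P 1)) * P 1 := by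
  have h : (X * P 0).degree < ((2 : ℕ) : WithBot ℕ) := by
    rw [degree_mul, degree_X, degree_eq hdeg hP]
    norm_num
  simpa [Finset.sum_range_succ] using eq_sum_of_degree_lt hdeg hP horth h

theorem X_mul_succ_eq (hdeg : ∀ n, (P n).natDegree = n) (hP : ∀ n, P n ≠ 0)
    (horth : ∀ i j, L (P i * P j) = if i = j then 1 else 0) (n : ℕ) :
    X * P (n + 1) = C (L (X * P n * P (n + 1))) * P n
      + C (L (X * P (n + 1) * P (n + 1))) * P (n + 1)
      + C (L (X * P (n + 1) * P (n + 2))) * P (n + 2) := by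
  have h : (X * P (n + 1)).degree < ((n + 3 : ℕ) : WithBot ℕ) := by
    rw [degree_mul, degree_X, degree_eq hdeg hP]
    exact_mod_cast (by omega : 1 + (n + 1) < n + 3)
  have hsum := eq_sum_of_degree_lt hdeg hP horth h
  rw [Finset.sum_range_succ, Finset.sum_range_succ, Finset.sum_range_succ,
    Finset.sum_eq_zero (fun k hk => by
      rw [map_X_mul_mul_eq_zero hdeg hP horth
        (by have := Finset.mem_range.mp hk; omega), C_0, zero_mul]), zero_add,
    show X * P (n + 1) * P n = X * P n * P (n + 1) by ring] at hsum
  exact hsum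

theorem christoffel_darboux (hdeg : ∀ n, (P n).natDegree = n) (hP : ∀ n, P n ≠ 0)
    (horth : ∀ i j, L (P i * P j) = if i = j then 1 else 0) (x y : ℝ) (n : ℕ) :
    (x - y) * ∑ k ∈ Finset.range (n + 1), (P k).eval x * (P k).eval y
      = L (X * P n * P (n + 1))
        * ((P (n + 1)).eval x * (P n).eval y - (P n).eval x * (P (n + 1)).eval y) := by
  induction n with
  | zero =>
    have hx := congrArg (eval x) (X_mul_zero_eq hdeg hP horth)
    have hy := congrArg (eval y) (X_mul_zero_eq hdeg hP horth)
    simp only [eval_mul, eval_add, eval_X, eval_C] at hx hy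
    simp only [zero_add, Finset.sum_range_one]
    linear_combination (P 0).eval y * hx - (P 0).eval x * hy
  | succ n ih =>
    have hx := congrArg (eval x) (X_mul_succ_eq hdeg hP horth n)
    have hy := congrArg (eval y) (X_mul_succ_eq hdeg hP horth n)
    simp only [eval_mul, eval_add, eval_X, eval_C] at hx hy
    rw [Finset.sum_range_succ, mul_add, ih]
    linear_combination (P (n + 1)).eval y * hx - (P (n + 1)).eval x * hy

/-- The divided difference of `p` at `x`, as a polynomial in the other variable. -/
noncomputable def dividedDifference (p : ℝ[X]) (x : ℝ) : ℝ[X] :=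
  ∑ k ∈ Finset.range (p.natDegree + 1),
    C (p.coeff k) * ∑ i ∈ Finset.range k, C (x ^ i) * X ^ (k - 1 - i)

theorem dividedDifference_mul (p : ℝ[X]) (x : ℝ) :
    dividedDifference p x * (C x - X) = C (p.eval x) - p := by
  have h : ∀ k, (∑ i ∈ Finset.range k, C (x ^ i) * (X : ℝ[X]) ^ (k - 1 - i)) * (C x - X)
      = C (x ^ k) - X ^ k := fun k => by
    simp_rw [C_pow]
    exact (Commute.all _ _).geom_sum₂_mul k
  rw [dividedDifference, Finset.sum_mul]
  simp_rw [mul_assoc, h, mul_sub, Finset.sum_sub_distrib]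
  rw [← as_sum_range_C_mul_X_pow, eval_eq_sum_range, map_sum]
  simp_rw [C_mul]

theorem exists_eval_eq_map_dividedDifference_mul (L : ℝ[X] →ₗ[ℝ] ℝ) (p q : ℝ[X]) :
    ∃ Q : ℝ[X], ∀ x, L (dividedDifference p x * q) = Q.eval x := by
  refine ⟨∑ k ∈ Finset.range (p.natDegree + 1),
    C (p.coeff k) * ∑ i ∈ Finset.range k, X ^ i * C (L (X ^ (k - 1 - i) * q)), fun x => ?_⟩
  simp only [dividedDifference, Finset.sum_mul, map_sum, mul_assoc, map_C_mul, eval_finsetSum,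
    eval_mul, eval_C, eval_pow, eval_X]

theorem derivative_eval_add_eq (hdeg : ∀ n, (P n).natDegree = n) (hP : ∀ n, P n ≠ 0)
    (horth : ∀ i j, L (P i * P j) = if i = j then 1 else 0)
    {ψ : ℝ[X]} (hparts : ∀ q, L (derivative q) = L (q * ψ)) (n : ℕ) (x : ℝ) :
    (derivative (P (n + 1))).eval x
        + L (X * P n * P (n + 1)) * L (dividedDifference ψ x * (P (n + 1) * P n))
          * (P (n + 1)).eval x
      = L (X * P n * P (n + 1)) * L (dividedDifference ψ x * P (n + 1) ^ 2)
          * (P n).eval x := by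
  set a := L (X * P n * P (n + 1))
  set d := dividedDifference ψ x
  set K : ℝ[X] := ∑ k ∈ Finset.range (n + 1), C ((P k).eval x) * P k with hK
  have hK_deg : (C (ψ.eval x) * K).degree < (n + 1 : ℕ) := by
    rw [hK, Finset.mul_sum, degree_lt_iff_coeff_zero]
    intro m hm
    rw [finsetSum_coeff]
    refine Finset.sum_eq_zero fun k hk => ?_
    rw [coeff_C_mul, coeff_C_mul, coeff_eq_zero_of_natDegree_lt, mul_zero, mul_zero]
    rw [hdeg]
    exact (Finset.mem_range.mp hk).trans_le hm
  have hK_mul : (C x - X) * K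
      = C a * (C ((P (n + 1)).eval x) * P n - C ((P n).eval x) * P (n + 1)) := by
    refine Polynomial.funext fun y => ?_
    have := christoffel_darboux hdeg hP horth x y n
    simpa [hK, eval_finsetSum] using this
  have hcoeff : ∀ k ∈ Finset.range (n + 1),
      L (derivative (P (n + 1)) * P k) = L (P (n + 1) * ψ * P k) := fun k hk => by
    have h0 : L (P (n + 1) * derivative (P k)) = 0 := by
      refine map_mul_eq_zero hdeg hP horth ((degree_derivative_le).trans_lt ?_)
      rw [degree_eq hdeg hP]
      exact_mod_cast Finset.mem_range.mp hk
    have h := hparts (P (n + 1) * P k)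
    rw [derivative_mul, map_add, h0, add_zero] at h
    rw [h]
    congr 1
    ring
  have hderiv : (derivative (P (n + 1))).eval x = L (P (n + 1) * ψ * K) := by
    have hlt : (derivative (P (n + 1))).degree < (n + 1 : ℕ) := by
      rw [← degree_eq hdeg hP]
      exact degree_derivative_lt (hP _)
    rw [eq_sum_of_degree_lt hdeg hP horth hlt, eval_finsetSum, hK, Finset.mul_sum, map_sum]
    refine Finset.sum_congr rfl fun k hk => ?_
    rw [hcoeff k hk, mul_left_comm, map_C_mul, eval_mul, eval_C, mul_comm]
  have hsplit : P (n + 1) * ψ * K = P (n + 1) * (C (ψ.eval x) * K)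
      + C (a * (P n).eval x) * (d * P (n + 1) ^ 2)
      - C (a * (P (n + 1)).eval x) * (d * (P (n + 1) * P n)) := by
    simp only [C_mul]
    linear_combination (P (n + 1) * K) * dividedDifference_mul ψ x - P (n + 1) * d * hK_mul
  rw [hderiv, hsplit, map_sub, map_add, map_mul_eq_zero hdeg hP horth hK_deg, map_C_mul,
    map_C_mul]
  ring

end Algebra

/-! Integration of polynomials against `exp (-φ)`. -/

section Analysis

open Filter Asymptotics Topology

variable {φ : ℝ[X]}

theorem tendsto_eval_mul_exp_neg_atTop (hφdeg : 1 ≤ φ.natDegree) (hφlead : 0 < φ.leadingCoeff)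
    (q : ℝ[X]) : Tendsto (fun x => q.eval x * Real.exp (-φ.eval x)) atTop (𝓝 0) := by
  have hφ : Tendsto (fun x => φ.eval x) atTop atTop :=
    φ.tendsto_atTop_of_leadingCoeff_nonneg (natDegree_pos_iff_degree_pos.mp hφdeg) hφlead.le
  have hO : (fun x => q.eval x) =O[atTop] fun x => (φ ^ q.natDegree).eval x := by
    refine Polynomial.isBigO_atTop_of_degree_le _ _ ?_
    have hφ0 : φ ≠ 0 := leadingCoeff_ne_zero.mp hφlead.ne'
    rw [degree_eq_natDegree (pow_ne_zero _ hφ0), natDegree_pow]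
    exact degree_le_natDegree.trans (by exact_mod_cast Nat.le_mul_of_pos_right _ hφdeg)
  refine (hO.mul (isBigO_refl _ _)).trans_tendsto ?_
  simpa [Function.comp_def] using
    (Real.tendsto_pow_mul_exp_neg_atTop_nhds_zero q.natDegree).comp hφ

theorem tendsto_eval_mul_exp_neg_atBot (hφdeg : 1 ≤ φ.natDegree) (hφlead : 0 < φ.leadingCoeff)
    (hφeven : ∀ x : ℝ, φ.eval (-x) = φ.eval x) (q : ℝ[X]) :
    Tendsto (fun x => q.eval x * Real.exp (-φ.eval x)) atBot (𝓝 0) := by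
  simpa [Function.comp_def, hφeven] using
    (tendsto_eval_mul_exp_neg_atTop hφdeg hφlead (q.comp (-X))).comp tendsto_neg_atBot_atTop

theorem integrable_eval_mul_exp_neg (hφdeg : 1 ≤ φ.natDegree) (hφlead : 0 < φ.leadingCoeff)
    (hφeven : ∀ x : ℝ, φ.eval (-x) = φ.eval x) (q : ℝ[X]) :
    Integrable fun x => q.eval x * Real.exp (-φ.eval x) := by
  have hcont : ∀ r : ℝ[X], Continuous fun x => r.eval x * Real.exp (-φ.eval x) := fun r => by
    fun_prop
  have hlim : Tendsto (fun x => (q * (1 + X ^ 2)).eval x * Real.exp (-φ.eval x))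
      (cocompact ℝ) (𝓝 0) := by
    rw [cocompact_eq_atBot_atTop]
    exact (tendsto_eval_mul_exp_neg_atBot hφdeg hφlead hφeven _).sup
      (tendsto_eval_mul_exp_neg_atTop hφdeg hφlead _)
  have hO : (fun x => q.eval x * Real.exp (-φ.eval x))
      =O[cocompact ℝ] fun x : ℝ => (1 + x ^ 2)⁻¹ := by
    have h := (hlim.isBigO_one ℝ).mul (isBigO_refl (fun x : ℝ => (1 + x ^ 2)⁻¹) (cocompact ℝ))
    refine h.congr (fun x => ?_) fun x => one_mul _
    have : (1 + x ^ 2) ≠ 0 := by positivity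
    simp only [eval_mul, eval_add, eval_one, eval_pow, eval_X]
    field_simp
  exact (hcont q).locallyIntegrable.integrable_of_isBigO_cocompact hO
    (integrable_inv_one_add_sq.integrableAtFilter _)

/-- Integration of polynomials against an integrable weight. -/
noncomputable def weightFunctional (w : ℝ → ℝ)
    (hw : ∀ q : ℝ[X], Integrable fun x => q.eval x * w x) : ℝ[X] →ₗ[ℝ] ℝ where
  toFun q := ∫ x, q.eval x * w x
  map_add' p q := by
    simp_rw [eval_add, add_mul]
    exact integral_add (hw p) (hw q)
  map_smul' c q := by
    simp_rw [eval_smul, smul_eq_mul, mul_assoc, integral_const_mul, RingHom.id_apply]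

theorem integral_derivative_mul_exp_neg (hφdeg : 1 ≤ φ.natDegree)
    (hφlead : 0 < φ.leadingCoeff) (hφeven : ∀ x : ℝ, φ.eval (-x) = φ.eval x) (q : ℝ[X]) :
    ∫ x, (derivative q).eval x * Real.exp (-φ.eval x)
      = ∫ x, (q * derivative φ).eval x * Real.exp (-φ.eval x) := by
  have hint := integrable_eval_mul_exp_neg hφdeg hφlead hφeven
  have hzero := integral_eq_zero_of_hasDerivAt_of_integrable
    (f := fun x => q.eval x * Real.exp (-φ.eval x))
    (f' := fun x => (derivative q).eval x * Real.exp (-φ.eval x)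
      - (q * derivative φ).eval x * Real.exp (-φ.eval x))
    (fun x => by
      refine ((q.hasDerivAt x).mul (φ.hasDerivAt x).neg.exp).congr_deriv ?_
      simp only [eval_mul, Pi.neg_apply]
      ring)
    ((hint _).sub (hint _)) (hint q)
  rw [integral_sub (hint _) (hint _)] at hzero
  exact sub_eq_zero.mp hzero

end Analysis

end OrthonormalPolynomials

open OrthonormalPolynomials

theorem stmt1 (φ : Polynomial ℝ) (hφdeg : 1 ≤ φ.natDegree)
    (hφlead : 0 < φ.leadingCoeff)
    (hφeven : ∀ x : ℝ, φ.eval (-x) = φ.eval x)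
    (ρ : ℝ → ℝ) (hρ : ∀ x : ℝ, ρ x = Real.exp (-φ.eval x))
    (P : ℕ → Polynomial ℝ)
    (hPdeg : ∀ n, (P n).natDegree = n)
    (hPlead : ∀ n, 0 < (P n).leadingCoeff)
    (hPorth : ∀ i j, (∫ x : ℝ, (P i).eval x * (P j).eval x * ρ x)
        = if i = j then (1 : ℝ) else 0)
    (a : ℕ → ℝ) (ha0 : a 0 = Real.sqrt (∫ x : ℝ, ρ x))
    (haS : ∀ n, 1 ≤ n → a n = ∫ x : ℝ, x * (P (n - 1)).eval x * (P n).eval x * ρ x)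
    (D : ℝ → ℝ → ℝ)
    (hD : ∀ x y : ℝ, D x y * (x - y)
        = (Polynomial.derivative φ).eval x - (Polynomial.derivative φ).eval y)
    (A B : ℕ → ℝ → ℝ)
    (hA : ∀ n, ∀ x : ℝ, A n x = a n * ∫ y : ℝ, D x y * (P n).eval y ^ 2 * ρ y)
    (hB : ∀ n, ∀ x : ℝ,
      B n x = a n * ∫ y : ℝ, D x y * (P n).eval y * (P (n - 1)).eval y * ρ y) :
    ∀ n, 1 ≤ n →
      (∀ x : ℝ, (Polynomial.derivative (P n)).eval x + B n x * (P n).eval x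
          = A n x * (P (n - 1)).eval x) ∧
      (∃ QA QB : Polynomial ℝ,
        (∀ x : ℝ, A n x = QA.eval x) ∧ (∀ x : ℝ, B n x = QB.eval x)) := by
  obtain rfl : ρ = fun x => Real.exp (-φ.eval x) := funext hρ
  have hint := integrable_eval_mul_exp_neg hφdeg hφlead hφeven
  set L := weightFunctional _ hint
  have hL : ∀ q : ℝ[X], L q = ∫ x, q.eval x * Real.exp (-φ.eval x) := fun _ => rfl
  have hP : ∀ n, P n ≠ 0 := fun n => leadingCoeff_ne_zero.mp (hPlead n).ne'
  have horth : ∀ i j, L (P i * P j) = if i = j then 1 else 0 := fun i j => by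
    simpa only [hL, eval_mul] using hPorth i j
  have hparts : ∀ q, L (derivative q) = L (q * derivative φ) :=
    integral_derivative_mul_exp_neg hφdeg hφlead hφeven
  have hD' : ∀ (x : ℝ) (q : ℝ[X]), L (dividedDifference (derivative φ) x * q)
      = ∫ y, D x y * (q.eval y * Real.exp (-φ.eval y)) := fun x q => by
    rw [hL]
    refine integral_congr_ae ?_
    filter_upwards [compl_mem_ae_iff.mpr (measure_singleton x)] with y hy
    have hne : x - y ≠ 0 := sub_ne_zero.mpr fun h => hy h.symm
    have hd := congrArg (eval y) (dividedDifference_mul (derivative φ) x)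
    simp only [eval_mul, eval_sub, eval_C, eval_X] at hd
    rw [eval_mul, mul_right_cancel₀ hne (hd.trans (hD x y).symm), mul_assoc]
  intro n hn
  obtain ⟨n, rfl⟩ := Nat.exists_eq_add_of_le' hn
  have ha : a (n + 1) = L (X * P n * P (n + 1)) := by
    rw [haS _ hn, hL]
    simp
  have hA' : ∀ x, A (n + 1) x
      = a (n + 1) * L (dividedDifference (derivative φ) x * P (n + 1) ^ 2) := fun x => by
    rw [hA, hD']
    simp only [eval_pow, mul_assoc]
  have hB' : ∀ x, B (n + 1) x
      = a (n + 1) * L (dividedDifference (derivative φ) x * (P (n + 1) * P n)) := fun x => by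
    rw [hB, hD']
    simp only [eval_mul, mul_assoc, Nat.add_sub_cancel]
  refine ⟨fun x => ?_, ?_⟩
  · rw [hA', hB', ha]
    exact derivative_eval_add_eq hPdeg hP horth hparts n x
  · obtain ⟨QA, hQA⟩ :=
      exists_eval_eq_map_dividedDifference_mul L (derivative φ) (P (n + 1) ^ 2)
    obtain ⟨QB, hQB⟩ :=
      exists_eval_eq_map_dividedDifference_mul L (derivative φ) (P (n + 1) * P n)
    refine ⟨C (a (n + 1)) * QA, C (a (n + 1)) * QB, fun x => ?_, fun x => ?_⟩
    · rw [hA', hQA, eval_mul, eval_C]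
    · rw [hB', hQB, eval_mul, eval_C]
end

section
/- Let φ(x) = Σ_{p=0}^{m} v_p x^{2p} with m ≥ 1 and v_m > 0, ρ = e^{-φ}, and for n ≥ 1 let A_n, B_n be the polynomials A_n(x) = a_n ∫_ℝ D(x,y) P̃_n(y)² ρ(y) dy and B_n(x) = a_n ∫_ℝ D(x,y) P̃_n(y) P̃_{n-1}(y) ρ(y) dy. Then for every n ≥ 2m−2 there exist real numbers A_{n,l} (0 ≤ l ≤ m−1) and B_{n,l} (0 ≤ l ≤ m−2) with A_n(x) = a_n Σ_{l=0}^{m-1} A_{n,l} x^{2l} and B_n(x) = a_n Σ_{l=0}^{m-2} B_{n,l} x^{2l+1}; moreover A_{n,m-1} = 2 m v_m, and there exists a constant C > 0 such that for all sufficiently large n, |A_{n,l}| ≤ C a_n^{2m−2−2l} for every 0 ≤ l ≤ m−1 and |B_{n,l}| ≤ C a_n^{2m−3−2l} for every 0 ≤ l ≤ m−2. -/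
open MeasureTheory Polynomial

/-- `P` is the sequence of orthonormal polynomials for the positive continuous weight `ρ`. -/
structure IsOrthonormalSeq (ρ : ℝ → ℝ) (P : ℕ → ℝ[X]) : Prop where
  continuous_weight : Continuous ρ
  weight_pos : ∀ x, 0 < ρ x
  natDegree_eq : ∀ n, (P n).natDegree = n
  leadingCoeff_pos : ∀ n, 0 < (P n).leadingCoeff
  integral_mul : ∀ i j, (∫ x : ℝ, (P i).eval x * (P j).eval x * ρ x) = if i = j then (1 : ℝ) else 0

namespace IsOrthonormalSeq

variable {ρ : ℝ → ℝ} {P : ℕ → ℝ[X]}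

lemma integrable_mul (h : IsOrthonormalSeq ρ P) (i j : ℕ) :
    Integrable fun x => (P i * P j).eval x * ρ x := by
  have hsq : ∀ i, Integrable fun x => (P i).eval x * (P i).eval x * ρ x := fun i => by
    by_contra hn
    have := h.integral_mul i i
    rw [integral_undef hn] at this
    simp at this
  refine ((hsq i).add (hsq j)).mono'
    (((P i * P j).continuous.mul h.continuous_weight).aestronglyMeasurable) (.of_forall fun x => ?_)
  have hρ := h.weight_pos x
  rw [Real.norm_eq_abs, abs_mul, abs_of_pos hρ, Pi.add_apply, ← add_mul, eval_mul]
  gcongr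
  set p := (P i).eval x
  set q := (P j).eval x
  exact abs_le.2 ⟨by nlinarith [sq_nonneg (p + q)], by nlinarith [sq_nonneg (p - q)]⟩

lemma ne_zero (h : IsOrthonormalSeq ρ P) (n : ℕ) : P n ≠ 0 :=
  leadingCoeff_ne_zero.1 (h.leadingCoeff_pos n).ne'

lemma span_range (h : IsOrthonormalSeq ρ P) : Submodule.span ℝ (Set.range P) = ⊤ :=
  Polynomial.Sequence.span
    ⟨P, fun i => by rw [degree_eq_natDegree (h.ne_zero i), h.natDegree_eq]⟩
    fun i => (h.leadingCoeff_pos i).ne'.isUnit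

lemma integrable (h : IsOrthonormalSeq ρ P) (q : ℝ[X]) :
    Integrable fun x => q.eval x * ρ x := by
  have hq : q ∈ Submodule.span ℝ (Set.range P) := h.span_range ▸ Submodule.mem_top
  induction hq using Submodule.span_induction with
  | mem q hq =>
    obtain ⟨i, rfl⟩ := hq
    have h0 : P 0 = C (P 0).leadingCoeff := by
      rw [leadingCoeff, h.natDegree_eq]
      exact eq_C_of_natDegree_eq_zero (h.natDegree_eq 0)
    refine ((h.integrable_mul i 0).const_mul (P 0).leadingCoeff⁻¹).congr (.of_forall fun x => ?_)
    have := (h.leadingCoeff_pos 0).ne'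
    simp only [eval_mul]
    rw [h0, eval_C, leadingCoeff_C]
    field_simp
  | zero => simp
  | add p q _ _ hp hq => simpa [add_mul] using! hp.add hq
  | smul c p _ hp => simpa [mul_assoc] using! hp.const_mul c

/-- Integration of polynomials against the weight. -/
noncomputable def expect (h : IsOrthonormalSeq ρ P) : ℝ[X] →ₗ[ℝ] ℝ where
  toFun q := ∫ x, q.eval x * ρ x
  map_add' p q := by
    simp only [eval_add, add_mul]
    exact integral_add (h.integrable p) (h.integrable q)
  map_smul' c p := by
    simp only [eval_smul, smul_eq_mul, mul_assoc, RingHom.id_apply]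
    exact integral_const_mul _ _

lemma expect_apply (h : IsOrthonormalSeq ρ P) (q : ℝ[X]) :
    h.expect q = ∫ x, q.eval x * ρ x := rfl

lemma expect_mul (h : IsOrthonormalSeq ρ P) (i j : ℕ) :
    h.expect (P i * P j) = if i = j then 1 else 0 := by
  simp only [expect_apply, eval_mul, h.integral_mul]

lemma expect_mono (h : IsOrthonormalSeq ρ P) {p q : ℝ[X]} (hpq : ∀ x, p.eval x ≤ q.eval x) :
    h.expect p ≤ h.expect q :=
  integral_mono (h.integrable p) (h.integrable q) fun x =>
    mul_le_mul_of_nonneg_right (hpq x) (h.weight_pos x).le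

lemma abs_expect_le (h : IsOrthonormalSeq ρ P) {p q : ℝ[X]}
    (hpq : ∀ x, |p.eval x| ≤ q.eval x) : |h.expect p| ≤ h.expect q := by
  refine abs_le.2 ⟨?_, h.expect_mono fun x => (le_abs_self _).trans (hpq x)⟩
  rw [neg_le, ← map_neg]
  exact h.expect_mono fun x => by simpa using (neg_le_abs _).trans (hpq x)

lemma eq_zero_of_expect_mul_self (h : IsOrthonormalSeq ρ P) {q : ℝ[X]}
    (hq : h.expect (q * q) = 0) : q = 0 := by
  by_contra hne
  obtain ⟨x, hx⟩ : ∃ x, q.eval x ≠ 0 := by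
    by_contra! hall
    exact hne (Polynomial.funext fun x => by simpa using hall x)
  refine (integral_pos_of_integrable_nonneg_nonzero (x := x)
    ((q * q).continuous.mul h.continuous_weight) (h.integrable (q * q)) (fun y => ?_) ?_).ne' hq
  · simpa using! mul_nonneg (mul_self_nonneg (q.eval y)) (h.weight_pos y).le
  · simpa using ⟨hx, (h.weight_pos x).ne'⟩

/-- Pairing a polynomial of degree at most `n` with `P n` extracts its `n`-th coefficient. -/
lemma expect_mul_of_natDegree_le (h : IsOrthonormalSeq ρ P) {q : ℝ[X]} {n : ℕ}
    (hq : q.natDegree ≤ n) : h.expect (q * P n) = q.coeff n / (P n).leadingCoeff := by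
  induction hd : q.natDegree using Nat.strong_induction_on generalizing q with
  | _ d ih =>
    obtain rfl | hq0 := eq_or_ne q 0
    · simp
    set c := q.leadingCoeff / (P d).leadingCoeff with hc
    have hPd := (h.leadingCoeff_pos d).ne'
    have hPn := (h.leadingCoeff_pos n).ne'
    have hsplit : q = (q - c • P d) + c • P d := by ring
    have hcoeff : ∀ k, (P k).coeff k = (P k).leadingCoeff := fun k => by
      rw [leadingCoeff, h.natDegree_eq]
    have hmain : h.expect (c • P d * P n) = (c • P d).coeff n / (P n).leadingCoeff := by
      rw [smul_mul_assoc, map_smul, h.expect_mul, coeff_smul]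
      split_ifs with hdn
      · subst hdn
        rw [hcoeff, smul_eq_mul, smul_eq_mul, mul_one, mul_div_assoc, div_self hPd, mul_one]
      · rw [coeff_eq_zero_of_natDegree_lt (by rw [h.natDegree_eq]; omega)]
        simp
    have hrest : h.expect ((q - c • P d) * P n) = (q - c • P d).coeff n / (P n).leadingCoeff := by
      have hdeg : (q - c • P d).natDegree ≤ d := (natDegree_sub_le _ _).trans
        (max_le hd.le ((natDegree_smul_le _ _).trans (h.natDegree_eq d).le))
      have hzero : (q - c • P d).coeff d = 0 := by
        rw [coeff_sub, coeff_smul, hcoeff, hc, smul_eq_mul, div_mul_cancel₀ _ hPd,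
          leadingCoeff, hd, sub_self]
      obtain hr | hr := eq_or_ne (q - c • P d) 0
      · simp [hr]
      · have hlt : (q - c • P d).natDegree < d := lt_of_le_of_ne hdeg fun he => by
          exact hr (leadingCoeff_eq_zero.1 (by rw [leadingCoeff, he, hzero]))
        exact ih _ hlt (by omega) rfl
    rw [hsplit, add_mul, map_add, hrest, hmain, coeff_add, add_div]

lemma coeff_self (h : IsOrthonormalSeq ρ P) (n : ℕ) : (P n).coeff n = (P n).leadingCoeff := by
  rw [leadingCoeff, h.natDegree_eq]

lemma expect_X_mul (h : IsOrthonormalSeq ρ P) (n : ℕ) :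
    h.expect (X * P n * P (n + 1)) = (P n).leadingCoeff / (P (n + 1)).leadingCoeff := by
  rw [h.expect_mul_of_natDegree_le, coeff_X_mul, h.coeff_self]
  rw [natDegree_X_mul (h.ne_zero n), h.natDegree_eq]

lemma expect_derivative_mul (h : IsOrthonormalSeq ρ P) (n : ℕ) :
    h.expect (derivative (P (n + 1) * P n)) =
      (n + 1) / h.expect (X * P n * P (n + 1)) := by
  have h1 := h.leadingCoeff_pos n
  have h2 := h.leadingCoeff_pos (n + 1)
  have hd : ∀ k, (derivative (P k)).natDegree ≤ k - 1 := fun k =>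
    (natDegree_derivative_le _).trans (by rw [h.natDegree_eq])
  rw [derivative_mul, map_add, mul_comm (P (n + 1)), h.expect_X_mul,
    h.expect_mul_of_natDegree_le (n := n) (hd (n + 1)),
    h.expect_mul_of_natDegree_le ((hd n).trans (by omega)), coeff_derivative, h.coeff_self,
    coeff_eq_zero_of_natDegree_lt ((hd n).trans_lt (by omega))]
  field_simp
  simp

lemma expect_derivative_X_mul (h : IsOrthonormalSeq ρ P) (n : ℕ) :
    h.expect (derivative (X * (P n * P n))) = 2 * n + 1 := by
  have h1 := h.leadingCoeff_pos n
  have hX : (X * derivative (P n)).coeff n = n * (P n).leadingCoeff := by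
    cases n with
    | zero => simp
    | succ n => rw [coeff_X_mul, coeff_derivative, h.coeff_self]; push_cast; ring
  have hd : (X * derivative (P n)).natDegree ≤ n := by
    cases n with
    | zero =>
      rw [eq_C_of_natDegree_eq_zero (h.natDegree_eq 0)]
      simp
    | succ n =>
      refine natDegree_mul_le.trans ?_
      have := natDegree_derivative_le (P (n + 1))
      rw [h.natDegree_eq] at this
      rw [natDegree_X]
      omega
  have : derivative (X * (P n * P n)) = P n * P n + (2 : ℝ) • (X * derivative (P n) * P n) := by
    rw [derivative_mul, derivative_mul, derivative_X, smul_eq_C_mul, C_ofNat]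
    ring
  rw [this, map_add, map_smul, h.expect_mul, if_pos rfl, h.expect_mul_of_natDegree_le hd, hX]
  field_simp
  ring

/-- Integration by parts against the weight. -/
lemma expect_derivative (h : IsOrthonormalSeq ρ P) {Q : ℝ[X]}
    (hQ : ∀ x, HasDerivAt ρ (-(Q.eval x * ρ x)) x) (q : ℝ[X]) :
    h.expect (derivative q) = h.expect (q * Q) := by
  have hInt : Integrable fun x => (derivative q - q * Q).eval x * ρ x := h.integrable _
  have := integral_eq_zero_of_hasDerivAt_of_integrable
    (f := fun x => q.eval x * ρ x) (fun x => ((q.hasDerivAt x).mul (hQ x)).congr_deriv (by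
      simp only [eval_sub, eval_mul]; ring)) hInt (h.integrable q)
  rw [← sub_eq_zero, ← map_sub]
  exact this

lemma expect_comp_neg_X (h : IsOrthonormalSeq ρ P) (heven : ∀ x, ρ (-x) = ρ x) (q : ℝ[X]) :
    h.expect (q.comp (-X)) = h.expect q := by
  rw [expect_apply, expect_apply, ← integral_neg_eq_self]
  simp [heven]

lemma comp_neg_X (h : IsOrthonormalSeq ρ P) (heven : ∀ x, ρ (-x) = ρ x) (n : ℕ) :
    (P n).comp (-X) = (-1 : ℝ) ^ n • P n := by
  have hdeg : ((P n).comp (-X)).natDegree = n := by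
    rw [natDegree_comp, natDegree_neg, natDegree_X, mul_one, h.natDegree_eq]
  set R := (P n).comp (-X) - (-1 : ℝ) ^ n • P n with hR
  have hcomp : (R.comp (-X)) = -(-1 : ℝ) ^ n • R := by
    rw [hR, sub_comp, comp_neg_X_comp_neg_X, smul_comp, smul_sub, smul_smul, neg_mul, ← mul_pow]
    simp
    ring
  have hRdeg : R.natDegree ≤ n := (natDegree_sub_le _ _).trans
    (max_le hdeg.le ((natDegree_smul_le _ _).trans (h.natDegree_eq n).le))
  have hRn : R.coeff n = 0 := by
    have := comp_neg_X_leadingCoeff_eq (P n)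
    rw [leadingCoeff, hdeg, h.natDegree_eq] at this
    rw [hR, coeff_sub, this, coeff_smul, h.coeff_self, smul_eq_mul, sub_self]
  have hRP : h.expect (R * P n) = 0 := by
    rw [h.expect_mul_of_natDegree_le hRdeg, hRn, zero_div]
  have hRP' : h.expect (R * (P n).comp (-X)) = 0 := by
    rw [← h.expect_comp_neg_X heven, mul_comp, comp_neg_X_comp_neg_X, hcomp, smul_mul_assoc,
      map_smul, hRP, smul_zero]
  refine sub_eq_zero.1 (h.eq_zero_of_expect_mul_self (q := R) ?_)
  nth_rewrite 2 [hR]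
  rw [mul_sub, map_sub, hRP', mul_smul_comm, map_smul, hRP, smul_zero, sub_zero]

lemma expect_eq_zero_of_odd (h : IsOrthonormalSeq ρ P) (heven : ∀ x, ρ (-x) = ρ x)
    {k i j : ℕ} (hodd : Odd (k + i + j)) : h.expect (X ^ k * (P i * P j)) = 0 := by
  have h1 := h.expect_comp_neg_X heven (X ^ k * (P i * P j))
  have h2 : (X ^ k * (P i * P j)).comp (-X) = -(X ^ k * (P i * P j)) := by
    rw [mul_comp, mul_comp, h.comp_neg_X heven, h.comp_neg_X heven, pow_comp, X_comp, neg_pow]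
    have : (-1 : ℝ[X]) ^ k * (-1) ^ i * (-1) ^ j = -1 := by
      rw [← pow_add, ← pow_add, hodd.neg_one_pow]
    simp only [smul_eq_C_mul, map_pow, map_neg, map_one]
    linear_combination (X ^ k * (P i * P j)) * this
  rw [h2, map_neg] at h1
  linarith

/-- If the moments of order `M` of `(P i)²` and `(P j)²` are at most `K r ^ M`, then the mixed
moments of order `k ≤ M` scale like `r ^ k`. -/
lemma abs_expect_le_of_moment_le (h : IsOrthonormalSeq ρ P) {M k i j : ℕ} (hk : k ≤ M)
    (hM : Even M) {r K : ℝ} (hr : 0 < r) (hi : h.expect (X ^ M * (P i * P i)) ≤ K * r ^ M)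
    (hj : h.expect (X ^ M * (P j * P j)) ≤ K * r ^ M) :
    |h.expect (X ^ k * (P i * P j))| ≤ (1 + K) * r ^ k := by
  have key := h.abs_expect_le (p := X ^ k * (P i * P j))
    (q := (r ^ k / 2) • ((P i * P i + P j * P j) +
      (r ^ M)⁻¹ • (X ^ M * (P i * P i) + X ^ M * (P j * P j)))) (fun x => by
    simp only [eval_mul, eval_pow, eval_X, eval_smul, eval_add, smul_eq_mul]
    set p := (P i).eval x
    set q := (P j).eval x
    have ht : |x| ^ k ≤ r ^ k * (1 + (r ^ M)⁻¹ * x ^ M) := by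
      have h0 : |x| = r * (|x| / r) := by field_simp
      have h1 : (r ^ M)⁻¹ * x ^ M = (|x| / r) ^ M := by
        rw [div_pow, hM.pow_abs, div_eq_inv_mul]
      rw [h1]
      nth_rewrite 1 [h0]
      have ht0 : 0 ≤ |x| / r := by positivity
      set t := |x| / r
      rw [mul_pow]
      gcongr
      rcases le_total t 1 with h' | h'
      · linarith [pow_le_one₀ ht0 h' (n := k), pow_nonneg ht0 M]
      · linarith [pow_le_pow_right₀ h' hk]
    have hpq : |p * q| ≤ (p * p + q * q) / 2 := abs_le.2
      ⟨by nlinarith [sq_nonneg (p + q)], by nlinarith [sq_nonneg (p - q)]⟩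
    calc |x ^ k * (p * q)| = |x| ^ k * |p * q| := by rw [abs_mul, abs_pow]
      _ ≤ (r ^ k * (1 + (r ^ M)⁻¹ * x ^ M)) * ((p * p + q * q) / 2) :=
        mul_le_mul ht hpq (abs_nonneg _) ((by positivity : (0 : ℝ) ≤ |x| ^ k).trans ht)
      _ = _ := by ring)
  refine key.trans ?_
  simp only [map_add, map_smul, h.expect_mul, if_true, smul_eq_mul]
  have hrM : 0 < r ^ M := by positivity
  have : (r ^ M)⁻¹ * (h.expect (X ^ M * (P i * P i)) + h.expect (X ^ M * (P j * P j)))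
      ≤ 2 * K := by
    rw [inv_mul_le_iff₀ hrM]
    linarith
  have hrk : 0 ≤ r ^ k / 2 := by positivity
  nlinarith [mul_le_mul_of_nonneg_left this hrk]

end IsOrthonormalSeq

lemma exists_abs_mul_pow_le (c : ℝ) {ε : ℝ} (hε : 0 < ε) {p m : ℕ} (hpm : p < m) :
    ∃ K, 0 ≤ K ∧ ∀ t : ℝ, 0 ≤ t → |c| * t ^ p ≤ ε * t ^ m + K := by
  set R := max 1 (|c| / ε)
  have hR1 : 1 ≤ R := le_max_left _ _
  have hRc : |c| ≤ R * ε := (div_le_iff₀ hε).1 (le_max_right _ _)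
  refine ⟨|c| * R ^ p, by positivity, fun t ht => ?_⟩
  rcases le_total t R with h | h
  · have : |c| * t ^ p ≤ |c| * R ^ p := by gcongr
    have : 0 ≤ ε * t ^ m := by positivity
    linarith
  · have h1 : t * t ^ p ≤ t ^ m := by
      rw [← pow_succ']
      exact pow_le_pow_right₀ (hR1.trans h) hpm
    have h2 : |c| * t ^ p ≤ t * ε * t ^ p := by
      gcongr
      exact hRc.trans (by gcongr)
    have : ε * (t * t ^ p) ≤ ε * t ^ m := by gcongr
    have : 0 ≤ |c| * R ^ p := by positivity
    linarith

/-- An even polynomial is bounded below by half its leading term, up to a constant. -/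
lemma exists_half_leading_term_sub_le (w : ℕ → ℝ) (m : ℕ) (hw : 0 < w m) :
    ∃ K, 0 ≤ K ∧ ∀ x : ℝ,
      w m / 2 * x ^ (2 * m) - K ≤ ∑ p ∈ Finset.range (m + 1), w p * x ^ (2 * p) := by
  have hε : 0 < w m / (2 * (m + 1)) := by positivity
  choose! K hK0 hK using fun p (hp : p < m) => exists_abs_mul_pow_le (w p) hε hp
  refine ⟨∑ p ∈ Finset.range m, K p,
    Finset.sum_nonneg fun p hp => hK0 p (Finset.mem_range.1 hp), fun x => ?_⟩
  have hsum : ∑ p ∈ Finset.range m, (-(w m / (2 * (m + 1)) * x ^ (2 * m)) - K p)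
      ≤ ∑ p ∈ Finset.range m, w p * x ^ (2 * p) := Finset.sum_le_sum fun p hp => by
    have h1 := hK p (Finset.mem_range.1 hp) (x ^ 2) (sq_nonneg x)
    rw [← pow_mul, ← pow_mul] at h1
    have h2 : -|w p| * x ^ (2 * p) ≤ w p * x ^ (2 * p) :=
      mul_le_mul_of_nonneg_right (neg_abs_le _) ((even_two_mul p).pow_nonneg x)
    linarith
  rw [Finset.sum_sub_distrib, Finset.sum_const, Finset.card_range, nsmul_eq_mul] at hsum
  rw [Finset.sum_range_succ]
  have hx : 0 ≤ x ^ (2 * m) := (even_two_mul m).pow_nonneg x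
  have hfrac : (m : ℝ) * (w m / (2 * (m + 1)) * x ^ (2 * m)) ≤ w m / 2 * x ^ (2 * m) := by
    rw [← mul_assoc]
    gcongr
    rw [← mul_div_assoc, div_le_div_iff₀ (by positivity) two_pos]
    nlinarith
  linarith

lemma Finset.sum_range_two_mul_sub_one (f : ℕ → ℝ) (m : ℕ) :
    ∑ k ∈ range (2 * m - 1), f k =
      ∑ l ∈ range m, f (2 * l) + ∑ l ∈ range (m - 1), f (2 * l + 1) := by
  induction m with
  | zero => simp
  | succ m ih =>
    cases m with
    | zero => simp
    | succ m =>
      rw [show 2 * (m + 1 + 1) - 1 = 2 * (m + 1) - 1 + 1 + 1 by omega, sum_range_succ,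
        sum_range_succ, ih, sum_range_succ _ (m + 1), show m + 1 + 1 - 1 = m + 1 by omega,
        show m + 1 - 1 = m by omega, sum_range_succ (fun l => f (2 * l + 1)),
        show 2 * (m + 1) - 1 = 2 * m + 1 by omega, show 2 * m + 1 + 1 = 2 * (m + 1) by omega]
      ring

/-- The coefficient of `x ^ k` when the divided difference of `∑ p ≤ m, w p * x ^ (2 * p - 1)`
is integrated in its second variable against a functional with moments `μ`. -/
def dividedDiffCoeff (w : ℕ → ℝ) (m : ℕ) (μ : ℕ → ℝ) (k : ℕ) : ℝ :=
  ∑ p ∈ Finset.range (m + 1), if k + 2 ≤ 2 * p then w p * μ (2 * p - 2 - k) else 0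

section dividedDiffCoeff

variable {w : ℕ → ℝ} {m : ℕ} {μ : ℕ → ℝ}

lemma sum_dividedDiffCoeff_mul_pow (x : ℝ) :
    ∑ p ∈ Finset.range (m + 1), ∑ k ∈ Finset.range (2 * p - 1),
        w p * x ^ k * μ (2 * p - 1 - 1 - k) =
      ∑ k ∈ Finset.range (2 * m - 1), dividedDiffCoeff w m μ k * x ^ k := by
  simp only [dividedDiffCoeff, Finset.sum_mul]
  rw [Finset.sum_comm]
  refine Finset.sum_congr rfl fun p hp => ?_
  rw [Finset.mem_range] at hp
  simp only [ite_mul, zero_mul]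
  rw [← Finset.sum_filter]
  refine Finset.sum_congr (Finset.ext fun k => ?_) fun k _ => ?_
  · simp only [Finset.mem_range, Finset.mem_filter]
    omega
  · rw [show 2 * p - 1 - 1 - k = 2 * p - 2 - k by omega]
    ring

lemma dividedDiffCoeff_eq_zero {k : ℕ} (hμ : ∀ j, Even (j + k) → μ j = 0) :
    dividedDiffCoeff w m μ k = 0 := by
  refine Finset.sum_eq_zero fun p _ => ?_
  split_ifs with h
  · rw [hμ _ ⟨p - 1, by omega⟩, mul_zero]
  · rfl

lemma dividedDiffCoeff_top (hm : 1 ≤ m) : dividedDiffCoeff w m μ (2 * (m - 1)) = w m * μ 0 := by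
  rw [dividedDiffCoeff, Finset.sum_range_succ, Finset.sum_eq_zero, if_pos (by omega), zero_add,
    show 2 * m - 2 - 2 * (m - 1) = 0 by omega]
  intro p hp
  rw [Finset.mem_range] at hp
  exact if_neg (by omega)

lemma abs_dividedDiffCoeff_le {K r : ℝ} (hK : 0 ≤ K) (hr : 1 ≤ r)
    (hμ : ∀ j ≤ 2 * m, |μ j| ≤ K * r ^ j) (k : ℕ) :
    |dividedDiffCoeff w m μ k| ≤
      (∑ p ∈ Finset.range (m + 1), |w p|) * K * r ^ (2 * m - 2 - k) := by
  rw [mul_assoc, Finset.sum_mul]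
  refine (Finset.abs_sum_le_sum_abs _ _).trans (Finset.sum_le_sum fun p hp => ?_)
  rw [Finset.mem_range] at hp
  split_ifs with h
  · rw [abs_mul]
    gcongr
    refine (hμ _ (by omega)).trans ?_
    gcongr
    omega
  · rw [abs_zero]
    positivity

end dividedDiffCoeff

namespace IsOrthonormalSeq

variable {ρ : ℝ → ℝ} {P : ℕ → ℝ[X]}

/-- Moments near index `n` scale with a length `r` controlled by the recursion coefficient. -/
theorem exists_moment_bound (h : IsOrthonormalSeq ρ P) {m : ℕ} (hm : 1 ≤ m) {w : ℕ → ℝ}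
    (hw : 0 < w m) (hw0 : w 0 = 0)
    (hρ : ∀ x, HasDerivAt ρ (-((∑ p ∈ Finset.range (m + 1), w p * x ^ (2 * p - 1)) * ρ x)) x) :
    ∃ K L : ℝ, 0 < K ∧ 1 ≤ L ∧ ∀ n, ∃ r : ℝ, 1 ≤ r ∧
      r ≤ L * h.expect (X * P n * P (n + 1)) ∧
      ∀ k ≤ 2 * m, |h.expect (X ^ k * (P (n + 1) * P (n + 1)))| ≤ K * r ^ k ∧
        |h.expect (X ^ k * (P (n + 1) * P n))| ≤ K * r ^ k := by
  set Q : ℝ[X] := ∑ p ∈ Finset.range (m + 1), w p • X ^ (2 * p - 1) with hQdef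
  have hQeval : ∀ x, Q.eval x = ∑ p ∈ Finset.range (m + 1), w p * x ^ (2 * p - 1) := fun x => by
    simp [hQdef, eval_finsetSum]
  have hQ : ∀ x, HasDerivAt ρ (-(Q.eval x * ρ x)) x := fun x => by
    rw [hQeval]
    exact hρ x
  obtain ⟨K₀, hK₀, hlow⟩ := exists_half_leading_term_sub_le w m hw
  have hxQ : ∀ x, x * Q.eval x = ∑ p ∈ Finset.range (m + 1), w p * x ^ (2 * p) := fun x => by
    rw [hQeval, Finset.mul_sum]
    refine Finset.sum_congr rfl fun p _ => ?_
    rcases Nat.eq_zero_or_pos p with rfl | hp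
    · simp [hw0]
    · rw [mul_left_comm, ← pow_succ', show 2 * p - 1 + 1 = 2 * p by omega]
  have hvirial : ∀ n, w m / 2 * h.expect (X ^ (2 * m) * (P n * P n)) ≤ 2 * n + 1 + K₀ := by
    intro n
    have hmono := h.expect_mono
      (p := (w m / 2) • (X ^ (2 * m) * (P n * P n)) - K₀ • (P n * P n))
      (q := X * (P n * P n) * Q) (fun x => by
        simp only [eval_sub, eval_smul, eval_mul, eval_pow, eval_X, smul_eq_mul]
        have := mul_le_mul_of_nonneg_right (hlow x) (mul_self_nonneg ((P n).eval x))
        rw [← hxQ] at this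
        linarith)
    rw [← h.expect_derivative hQ, h.expect_derivative_X_mul, map_sub, map_smul, map_smul,
      h.expect_mul, if_pos rfl, smul_eq_mul, smul_eq_mul] at hmono
    linarith
  set K₁ := (3 + K₀) / (w m / 2) with hK₁
  have hK₁pos : 0 < K₁ := by positivity
  set W := ∑ p ∈ Finset.range (m + 1), |w p| with hW
  have hW0 : 0 ≤ W := Finset.sum_nonneg fun _ _ => abs_nonneg _
  refine ⟨1 + K₁, max 1 (W * (1 + K₁)), by positivity, le_max_left _ _, fun n => ?_⟩
  set r : ℝ := ((n : ℝ) + 1) ^ ((2 * m : ℕ) : ℝ)⁻¹ with hrdef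
  have hr1 : 1 ≤ r := Real.one_le_rpow (by linarith [n.cast_nonneg (α := ℝ)]) (by positivity)
  have hr0 : 0 < r := by linarith
  have hrm : r ^ (2 * m) = n + 1 := Real.rpow_inv_natCast_pow (by positivity) (by omega)
  have hmom : ∀ i ≤ n + 1, h.expect (X ^ (2 * m) * (P i * P i)) ≤ K₁ * r ^ (2 * m) := by
    intro i hi
    have hi' : (i : ℝ) ≤ n + 1 := by exact_mod_cast hi
    rw [hrm, hK₁, div_mul_eq_mul_div, le_div_iff₀ (by positivity), mul_comm]
    have := hvirial i
    nlinarith [n.cast_nonneg (α := ℝ)]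
  have hbound : ∀ k ≤ 2 * m, ∀ i ≤ n + 1, ∀ j ≤ n + 1,
      |h.expect (X ^ k * (P i * P j))| ≤ (1 + K₁) * r ^ k := fun k hk i hi j hj =>
    h.abs_expect_le_of_moment_le hk (even_two_mul m) hr0 (hmom i hi) (hmom j hj)
  refine ⟨r, hr1, ?_, fun k hk => ⟨hbound k hk _ le_rfl _ le_rfl, hbound k hk _ le_rfl n (by omega)⟩⟩
  set α := h.expect (X * P n * P (n + 1)) with hα
  have hα0 : 0 < α := by
    rw [hα, h.expect_X_mul]
    exact div_pos (h.leadingCoeff_pos _) (h.leadingCoeff_pos _)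
  have hfreud : r ^ (2 * m) = α * h.expect (P (n + 1) * P n * Q) := by
    rw [← h.expect_derivative hQ, h.expect_derivative_mul, hrm, ← hα]
    field_simp
  have hQle : h.expect (P (n + 1) * P n * Q) ≤ W * (1 + K₁) * r ^ (2 * m - 1) := by
    rw [hQdef, Finset.mul_sum, map_sum, hW, mul_assoc, Finset.sum_mul]
    refine Finset.sum_le_sum fun p hp => ?_
    rw [Finset.mem_range] at hp
    rw [mul_smul_comm, map_smul, smul_eq_mul, mul_comm (P (n + 1) * P n)]
    refine (le_abs_self _).trans ?_
    rw [abs_mul]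
    gcongr
    refine (hbound _ (by omega) _ le_rfl n (by omega)).trans ?_
    gcongr
    omega
  have hle : r * r ^ (2 * m - 1) ≤ (W * (1 + K₁) * α) * r ^ (2 * m - 1) := by
    rw [← pow_succ', show 2 * m - 1 + 1 = 2 * m by omega, hfreud]
    calc _ ≤ α * (W * (1 + K₁) * r ^ (2 * m - 1)) := by gcongr
      _ = _ := by ring
  refine (le_of_mul_le_mul_right hle (by positivity)).trans ?_
  gcongr
  exact le_max_right _ _

lemma integral_divided_diff (h : IsOrthonormalSeq ρ P) {m : ℕ} {w : ℕ → ℝ} {D : ℝ → ℝ → ℝ}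
    (hD : ∀ x y, D x y * (x - y) = ∑ p ∈ Finset.range (m + 1), w p * x ^ (2 * p - 1)
      - ∑ p ∈ Finset.range (m + 1), w p * y ^ (2 * p - 1)) (i j : ℕ) (x : ℝ) :
    ∫ y, D x y * ((P i).eval y * (P j).eval y) * ρ y =
      ∑ k ∈ Finset.range (2 * m - 1),
        dividedDiffCoeff w m (fun k => h.expect (X ^ k * (P i * P j))) k * x ^ k := by
  rw [← sum_dividedDiffCoeff_mul_pow]
  simp only [← smul_eq_mul (_ * _), ← map_smul, ← map_sum]
  refine integral_congr_ae ?_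
  filter_upwards [Measure.ae_ne volume x] with y hy
  have hDxy : D x y = ∑ p ∈ Finset.range (m + 1), ∑ k ∈ Finset.range (2 * p - 1),
      w p * x ^ k * y ^ (2 * p - 1 - 1 - k) := by
    apply mul_right_cancel₀ (sub_ne_zero.2 hy.symm)
    rw [hD, ← Finset.sum_sub_distrib, Finset.sum_mul]
    refine Finset.sum_congr rfl fun p _ => ?_
    simp only [mul_assoc]
    rw [← Finset.mul_sum, mul_assoc, geom_sum₂_mul]
    ring
  simp only [hDxy, eval_finsetSum, eval_smul, eval_mul, eval_pow, eval_X, smul_eq_mul,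
    Finset.sum_mul, mul_assoc]

end IsOrthonormalSeq

theorem stmt4 (m : ℕ) (hm : 1 ≤ m) (v : ℕ → ℝ) (hv : 0 < v m)
    (φ : ℝ → ℝ)
    (hφ : ∀ x : ℝ, φ x = ∑ p ∈ Finset.range (m + 1), v p * x ^ (2 * p))
    (dφ : ℝ → ℝ)
    (hdφ : ∀ x : ℝ, dφ x = ∑ p ∈ Finset.range (m + 1),
      (2 * (p : ℝ)) * v p * x ^ (2 * p - 1))
    (ρ : ℝ → ℝ) (hρ : ∀ x : ℝ, ρ x = Real.exp (-φ x))
    (P : ℕ → Polynomial ℝ)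
    (hPdeg : ∀ n, (P n).natDegree = n)
    (hPlead : ∀ n, 0 < (P n).leadingCoeff)
    (hPorth : ∀ i j, (∫ x : ℝ, (P i).eval x * (P j).eval x * ρ x)
        = if i = j then (1 : ℝ) else 0)
    (a : ℕ → ℝ) (ha0 : a 0 = Real.sqrt (∫ x : ℝ, ρ x))
    (haS : ∀ n, 1 ≤ n → a n = ∫ x : ℝ, x * (P (n - 1)).eval x * (P n).eval x * ρ x)
    (D : ℝ → ℝ → ℝ)
    (hD : ∀ x y : ℝ, D x y * (x - y) = dφ x - dφ y)
    (A B : ℕ → ℝ → ℝ)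
    (hA : ∀ n, ∀ x : ℝ, A n x = a n * ∫ y : ℝ, D x y * (P n).eval y ^ 2 * ρ y)
    (hB : ∀ n, ∀ x : ℝ,
      B n x = a n * ∫ y : ℝ, D x y * (P n).eval y * (P (n - 1)).eval y * ρ y) :
    ∃ (Ac Bc : ℕ → ℕ → ℝ) (C : ℝ) (N₁ : ℕ), 0 < C ∧
      (∀ n, 1 ≤ n → 2 * m - 2 ≤ n →
        (∀ x : ℝ, A n x = a n * ∑ l ∈ Finset.range m, Ac n l * x ^ (2 * l)) ∧
        (∀ x : ℝ, B n x = a n * ∑ l ∈ Finset.range (m - 1), Bc n l * x ^ (2 * l + 1)) ∧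
        Ac n (m - 1) = 2 * (m : ℝ) * v m) ∧
      (∀ n, N₁ ≤ n →
        (∀ l < m, |Ac n l| ≤ C * a n ^ (2 * m - 2 - 2 * l)) ∧
        (∀ l < m - 1, |Bc n l| ≤ C * a n ^ (2 * m - 3 - 2 * l))) := by
  set w : ℕ → ℝ := fun p => 2 * (p : ℝ) * v p with hw
  have hwm : 0 < w m := by
    have : (0 : ℝ) < m := by exact_mod_cast hm
    simp only [hw]
    positivity
  have hderiv : ∀ x, HasDerivAt ρ
      (-((∑ p ∈ Finset.range (m + 1), w p * x ^ (2 * p - 1)) * ρ x)) x := fun x => by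
    have hφ' : HasDerivAt φ (∑ p ∈ Finset.range (m + 1), w p * x ^ (2 * p - 1)) x := by
      rw [funext hφ]
      refine HasDerivAt.fun_sum fun p _ => ?_
      refine ((hasDerivAt_pow (2 * p) x).const_mul (v p)).congr_deriv ?_
      simp only [hw]
      push_cast
      ring
    rw [funext hρ]
    exact hφ'.fun_neg.exp.congr_deriv (by ring)
  have heven : ∀ x, ρ (-x) = ρ x := fun x => by
    simp only [hρ, hφ, (even_two_mul _).neg_pow]
  have h : IsOrthonormalSeq ρ P :=
    ⟨continuous_iff_continuousAt.2 fun x => (hderiv x).continuousAt,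
      fun x => by rw [hρ]; exact Real.exp_pos _, hPdeg, hPlead, hPorth⟩
  have hD' : ∀ x y, D x y * (x - y) = ∑ p ∈ Finset.range (m + 1), w p * x ^ (2 * p - 1)
      - ∑ p ∈ Finset.range (m + 1), w p * y ^ (2 * p - 1) := fun x y => by
    rw [hD, hdφ, hdφ]
  have ha : ∀ n, a (n + 1) = h.expect (X * P n * P (n + 1)) := fun n => by
    rw [haS _ n.succ_pos, h.expect_apply]
    simp
  obtain ⟨K, L, hK, hL, hbound⟩ := h.exists_moment_bound hm hwm (by simp [hw]) hderiv
  set μ : ℕ → ℕ → ℕ → ℝ := fun i j k => h.expect (X ^ k * (P i * P j)) with hμ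
  set W := ∑ p ∈ Finset.range (m + 1), |w p| with hW
  have hW0 : 0 ≤ W := Finset.sum_nonneg fun _ _ => abs_nonneg _
  have hcoeff : ∀ n j, j = n ∨ j = n + 1 → ∀ k,
      |dividedDiffCoeff w m (μ (n + 1) j) k| ≤
        (W * K * L ^ (2 * m) + 1) * a (n + 1) ^ (2 * m - 2 - k) := by
    intro n j hj k
    obtain ⟨r, hr, hra, hmom⟩ := hbound n
    rw [← ha] at hra
    have ha0 : 0 ≤ a (n + 1) := by
      by_contra! hneg
      nlinarith
    calc _ ≤ W * K * r ^ (2 * m - 2 - k) := abs_dividedDiffCoeff_le hK.le hr (fun i hi => by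
            rcases hj with rfl | rfl
            exacts [(hmom i hi).2, (hmom i hi).1]) k
      _ ≤ W * K * (L * a (n + 1)) ^ (2 * m - 2 - k) := by gcongr
      _ = W * K * L ^ (2 * m - 2 - k) * a (n + 1) ^ (2 * m - 2 - k) := by rw [mul_pow]; ring
      _ ≤ W * K * L ^ (2 * m) * a (n + 1) ^ (2 * m - 2 - k) := by
        gcongr
        omega
      _ ≤ _ := by
        gcongr
        linarith
  refine ⟨fun n l => dividedDiffCoeff w m (μ n n) (2 * l),
    fun n l => dividedDiffCoeff w m (μ n (n - 1)) (2 * l + 1),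
    W * K * L ^ (2 * m) + 1, 1, by positivity, fun n hn _ => ⟨fun x => ?_, fun x => ?_, ?_⟩,
    fun n hn => ⟨fun l _ => ?_, fun l _ => ?_⟩⟩
  · have hInt := h.integral_divided_diff hD' n n x
    simp only [← sq] at hInt
    rw [hA, hInt, Finset.sum_range_two_mul_sub_one, add_eq_left.2]
    · simp only [hμ, sq]
    · refine Finset.sum_eq_zero fun l _ => ?_
      rw [dividedDiffCoeff_eq_zero, zero_mul]
      intro j hj
      rw [sq]
      exact h.expect_eq_zero_of_odd heven (by grind)
  · have hInt := h.integral_divided_diff hD' n (n - 1) x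
    simp only [← mul_assoc (D _ _)] at hInt
    rw [hB, hInt, Finset.sum_range_two_mul_sub_one, add_eq_right.2]
    refine Finset.sum_eq_zero fun l _ => ?_
    rw [dividedDiffCoeff_eq_zero, zero_mul]
    exact fun j hj => h.expect_eq_zero_of_odd heven (by grind)
  · simp only [dividedDiffCoeff_top hm, hμ, pow_zero, one_mul, h.expect_mul, if_true, mul_one, hw]
  · obtain ⟨n, rfl⟩ := Nat.exists_eq_add_of_le' hn
    exact hcoeff n (n + 1) (.inr rfl) (2 * l)
  · obtain ⟨n, rfl⟩ := Nat.exists_eq_add_of_le' hn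
    have := hcoeff n n (.inl rfl) (2 * l + 1)
    rwa [show 2 * m - 2 - (2 * l + 1) = 2 * m - 3 - 2 * l by omega] at this
end

section
/- Let φ be an even nonconstant polynomial of degree 2m with positive leading coefficient, ρ = e^{-φ}, and A_n(x) = a_n ∫_ℝ D(x,y) P̃_n(y)² ρ(y) dy. There exists N_0 ∈ ℕ such that for all n ≥ N_0: all the coefficients of A_n in the standard basis are positive; A_n(x) > 0 for every x ∈ ℝ; A_n is even and attains its global minimum at 0; and consequently 0 < 1/A_n(x) ≤ 1/A_n(0) for every x ∈ ℝ, i.e., ‖1/A_n‖_{L^∞(ℝ)} ≤ 1/A_n(0). -/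
open MeasureTheory Polynomial

theorem Polynomial.coeff_comp_neg_X (p : ℝ[X]) (k : ℕ) :
    (p.comp (-X)).coeff k = (-1) ^ k * p.coeff k := by
  have : (-X : ℝ[X]) = C (-1) * X := by simp
  rw [this, comp_C_mul_X_coeff, mul_comm]

/-- A sequence of polynomials, one in each degree, with positive leading coefficients, orthonormal
for the bilinear form `(p, q) ↦ L (p * q)`. -/
structure IsOrthonormalFor (L : ℝ[X] →ₗ[ℝ] ℝ) (P : ℕ → ℝ[X]) : Prop where
  natDegree_eq : ∀ n, (P n).natDegree = n
  leadingCoeff_pos : ∀ n, 0 < (P n).leadingCoeff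
  map_mul_ite : ∀ i j, L (P i * P j) = if i = j then 1 else 0

namespace IsOrthonormalFor

variable {L : ℝ[X] →ₗ[ℝ] ℝ} {P : ℕ → ℝ[X]}

theorem coeff_self_pos (h : IsOrthonormalFor L P) (n : ℕ) : 0 < (P n).coeff n := by
  have := h.leadingCoeff_pos n
  rwa [leadingCoeff, h.natDegree_eq] at this

theorem degree_eq (h : IsOrthonormalFor L P) (n : ℕ) : (P n).degree = n := by
  have h0 : P n ≠ 0 := fun h0 => (h.coeff_self_pos n).ne' (by simp [h0])
  rw [degree_eq_natDegree h0, h.natDegree_eq]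

/-- Subtracting the multiple of `P n` with the same leading term lowers the degree. -/
theorem degree_sub_smul_lt (h : IsOrthonormalFor L P) {n : ℕ} {q : ℝ[X]} (hq : q.natDegree ≤ n) :
    (q - (q.coeff n / (P n).coeff n) • P n).degree < n := by
  rw [degree_lt_iff_coeff_zero]
  intro k hk
  rcases hk.eq_or_lt with rfl | hk
  · have := (h.coeff_self_pos n).ne'
    simp [this]
  · rw [coeff_sub, coeff_smul, coeff_eq_zero_of_natDegree_lt (hq.trans_lt hk),
      coeff_eq_zero_of_natDegree_lt ((h.natDegree_eq n).trans_lt hk)]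
    simp

theorem map_mul_eq_zero (h : IsOrthonormalFor L P) {n : ℕ} {q : ℝ[X]} (hq : q.degree < n) :
    L (q * P n) = 0 := by
  suffices H : ∀ d ≤ n, ∀ q : ℝ[X], q.degree < d → L (q * P n) = 0 from H n le_rfl q hq
  intro d
  induction d with
  | zero =>
    intro _ q hq
    have : q = 0 := by simpa using hq
    simp [this]
  | succ d ih =>
    intro hd q hq
    have hq' : q.natDegree ≤ d := by
      rw [natDegree_le_iff_coeff_eq_zero]
      exact (degree_lt_iff_coeff_zero q (d + 1)).mp hq
    have key := ih (by omega) _ (h.degree_sub_smul_lt hq')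
    rw [sub_mul, map_sub, smul_mul_assoc, map_smul, h.map_mul_ite, if_neg (by omega)] at key
    simpa using key

theorem map_mul_eq_div (h : IsOrthonormalFor L P) {n : ℕ} {q : ℝ[X]} (hq : q.natDegree ≤ n) :
    L (q * P n) = q.coeff n / (P n).coeff n := by
  have key := h.map_mul_eq_zero (h.degree_sub_smul_lt hq)
  rw [sub_mul, map_sub, smul_mul_assoc, map_smul, h.map_mul_ite, if_pos rfl] at key
  simpa [sub_eq_zero] using key

theorem eq_zero_of_forall_map_mul (h : IsOrthonormalFor L P) {q : ℝ[X]}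
    (hq : ∀ i ≤ q.natDegree, L (q * P i) = 0) : q = 0 := by
  have := h.map_mul_eq_div (le_refl q.natDegree)
  rw [hq _ le_rfl, eq_comm, div_eq_zero_iff] at this
  exact leadingCoeff_eq_zero.mp (this.resolve_right (h.coeff_self_pos _).ne')

/-- Orthonormal polynomials of an even functional have the parity of their degree. -/
theorem comp_neg_X (h : IsOrthonormalFor L P) (hL : ∀ p : ℝ[X], L (p.comp (-X)) = L p) (n : ℕ) :
    (P n).comp (-X) = (-1) ^ n * P n := by
  set q := (P n).comp (-X) - (-1) ^ n * P n with hq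
  have hC : ((-1 : ℝ[X]) ^ n) = C ((-1) ^ n) := by simp
  have hdeg : q.degree < n := by
    rw [degree_lt_iff_coeff_zero]
    intro k hk
    rw [hq, hC, coeff_sub, coeff_comp_neg_X, coeff_C_mul]
    rcases hk.eq_or_lt with rfl | hk
    · simp
    · rw [coeff_eq_zero_of_natDegree_lt ((h.natDegree_eq n).trans_lt hk)]
      simp
  suffices q = 0 from sub_eq_zero.mp this
  by_contra h0
  refine h0 (h.eq_zero_of_forall_map_mul fun i hi => ?_)
  have hi : i < n := by
    rw [degree_eq_natDegree h0] at hdeg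
    exact hi.trans_lt (by exact_mod_cast hdeg)
  have h1 : L ((P n).comp (-X) * P i) = 0 := by
    rw [← hL, mul_comp, comp_neg_X_comp_neg_X, mul_comm]
    refine h.map_mul_eq_zero ?_
    rw [degree_lt_iff_coeff_zero]
    intro k hk
    rw [coeff_comp_neg_X,
      coeff_eq_zero_of_natDegree_lt ((h.natDegree_eq i).trans_lt (hi.trans_le hk)), mul_zero]
  rw [hq, sub_mul, map_sub, h1, hC, mul_assoc, ← smul_eq_C_mul, map_smul, h.map_mul_ite,
    if_neg (by omega)]
  simp

theorem map_X_pow_mul_sq_eq_zero (h : IsOrthonormalFor L P)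
    (hL : ∀ p : ℝ[X], L (p.comp (-X)) = L p) (n : ℕ) {j : ℕ} (hj : Odd j) :
    L (X ^ j * P n ^ 2) = 0 := by
  have key : L (X ^ j * P n ^ 2) = -L (X ^ j * P n ^ 2) := by
    conv_lhs => rw [← hL]
    rw [mul_comp, pow_comp, pow_comp, X_comp, h.comp_neg_X hL, mul_pow, ← pow_mul, mul_comm n,
      (even_two_mul n).neg_one_pow, one_mul, hj.neg_pow, neg_mul, map_neg]
  linarith

theorem map_sq (h : IsOrthonormalFor L P) (n : ℕ) : L (P n ^ 2) = 1 := by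
  rw [pow_two, h.map_mul_ite, if_pos rfl]

theorem map_X_mul_mul (h : IsOrthonormalFor L P) (n : ℕ) :
    L (X * P n * P (n + 1)) = (P n).coeff n / (P (n + 1)).coeff (n + 1) := by
  rw [h.map_mul_eq_div, coeff_X_mul]
  exact natDegree_mul_le.trans (by rw [h.natDegree_eq, natDegree_X, add_comm])

theorem map_derivative_mul (h : IsOrthonormalFor L P) (n : ℕ) :
    L (derivative (P (n + 1)) * P n) = (n + 1) * (P (n + 1)).coeff (n + 1) / (P n).coeff n := by
  rw [h.map_mul_eq_div, coeff_derivative, mul_comm (_ + _)]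
  exact (natDegree_derivative_le _).trans (by simp [h.natDegree_eq])

theorem map_X_mul_derivative_mul (h : IsOrthonormalFor L P) (n : ℕ) :
    L (X * derivative (P n) * P n) = n := by
  have h0 := (h.coeff_self_pos n).ne'
  have hc : ∀ n (p : ℝ[X]), (X * derivative p).coeff n = n * p.coeff n := by
    rintro (_ | n) p
    · simp
    · rw [coeff_X_mul, coeff_derivative, mul_comm]
      simp
  rw [h.map_mul_eq_div, hc, mul_div_cancel_right₀ _ h0]
  refine natDegree_le_iff_coeff_eq_zero.mpr fun k hk => ?_
  rw [hc, coeff_eq_zero_of_natDegree_lt ((h.natDegree_eq n).trans_lt hk), mul_zero]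

variable {φ : ℝ[X]}

theorem map_X_mul_derivative_potential_mul_sq (h : IsOrthonormalFor L P)
    (hparts : ∀ p, L (derivative p) = L (derivative φ * p)) (n : ℕ) :
    L (X * derivative φ * P n ^ 2) = 2 * n + 1 := by
  have e1 : X * derivative φ * P n ^ 2 = derivative φ * (X * P n ^ 2) := by ring
  have e2 : derivative (X * P n ^ 2) = P n ^ 2 + (2 : ℝ) • (X * derivative (P n) * P n) := by
    simp only [derivative_mul, derivative_X, derivative_pow, smul_eq_C_mul]
    simp
    ring
  rw [e1, ← hparts, e2, map_add, map_smul, h.map_sq, h.map_X_mul_derivative_mul]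
  simp [add_comm]

/-- Freud's equation. -/
theorem map_derivative_potential_mul_mul (h : IsOrthonormalFor L P)
    (hparts : ∀ p, L (derivative p) = L (derivative φ * p)) (n : ℕ) :
    L (derivative φ * (P (n + 1) * P n)) =
      (n + 1) * (P (n + 1)).coeff (n + 1) / (P n).coeff n := by
  rw [← hparts, derivative_mul, map_add, h.map_derivative_mul, mul_comm (P (n + 1)),
    h.map_mul_eq_zero, add_zero]
  rw [degree_lt_iff_coeff_zero]
  intro k hk
  exact coeff_eq_zero_of_natDegree_lt
    ((natDegree_derivative_le _).trans_lt (by rw [h.natDegree_eq]; omega))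


theorem tendsto_coeff_div_coeff (h : IsOrthonormalFor L P)
    (hpos : ∀ p : ℝ[X], (∀ x, 0 ≤ p.eval x) → 0 ≤ L p)
    (hparts : ∀ p, L (derivative p) = L (derivative φ * p))
    (hφ : ∀ ε > 0, ∃ c, ∀ y, |(derivative φ).eval y| ≤ ε * (y * (derivative φ).eval y) + c) :
    Filter.Tendsto (fun n => (P n).coeff n / (P (n + 1)).coeff (n + 1))
      Filter.atTop Filter.atTop := by
  have bound : ∀ ε > 0, ∃ c, ∀ n : ℕ,
      (n + 1 : ℝ) ≤ (P n).coeff n / (P (n + 1)).coeff (n + 1) * (2 * ε * (n + 1) + c) := by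
    intro ε hε
    obtain ⟨c, hc⟩ := hφ ε hε
    refine ⟨c, fun n => ?_⟩
    have h1 := hpos ((ε • (X * derivative φ) + C c) * (P (n + 1) ^ 2 + P n ^ 2)
      - (2 : ℝ) • (derivative φ * (P (n + 1) * P n))) fun y => by
      simp only [eval_sub, eval_mul, eval_add, eval_smul, eval_X, eval_C, eval_pow, smul_eq_mul]
      have hy := hc y
      set d := (derivative φ).eval y
      set s := (P (n + 1)).eval y
      set t := (P n).eval y
      obtain ⟨hd1, hd2⟩ := abs_le.mp hy
      nlinarith [mul_nonneg (sub_nonneg.mpr hd2) (sq_nonneg (s + t)),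
        mul_nonneg (neg_le_iff_add_nonneg.mp hd1) (sq_nonneg (s - t))]
    have e : (ε • (X * derivative φ) + C c) * (P (n + 1) ^ 2 + P n ^ 2)
        = ε • (X * derivative φ * P (n + 1) ^ 2) + ε • (X * derivative φ * P n ^ 2)
          + c • P (n + 1) ^ 2 + c • P n ^ 2 := by
      simp only [smul_eq_C_mul]
      ring
    rw [e] at h1
    simp only [map_add, map_sub, map_smul, h.map_sq,
      h.map_X_mul_derivative_potential_mul_sq hparts, h.map_derivative_potential_mul_mul hparts,
      smul_eq_mul] at h1
    push_cast at h1
    have hn := h.coeff_self_pos n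
    have hn' := h.coeff_self_pos (n + 1)
    have h2 : (n + 1) * (P (n + 1)).coeff (n + 1) / (P n).coeff n ≤ 2 * ε * (n + 1) + c := by
      linarith
    rw [div_le_iff₀ hn] at h2
    rw [div_mul_eq_mul_div, le_div_iff₀ hn']
    linarith
  rw [Filter.tendsto_atTop]
  intro b
  set K := max b 1
  have hK : 0 < K := lt_max_of_lt_right one_pos
  obtain ⟨c, hc⟩ := bound (1 / (4 * K)) (by positivity)
  filter_upwards [Filter.eventually_ge_atTop ⌈2 * K * c⌉₊] with n hn
  have hn : 2 * K * c ≤ n := (Nat.le_ceil _).trans (by exact_mod_cast hn)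
  refine (le_max_left b 1).trans ?_
  change K ≤ _
  have h1 := hc n
  set r := (P n).coeff n / (P (n + 1)).coeff (n + 1)
  have hr : 0 < r := div_pos (h.coeff_self_pos n) (h.coeff_self_pos _)
  have h2 : 2 * (1 / (4 * K)) * (n + 1) + c ≤ (n + 1) / K := by
    rw [le_div_iff₀ hK]
    have : (2 * (1 / (4 * K)) * (n + 1) + c) * K = (n + 1) / 2 + K * c := by
      field_simp
      ring
    rw [this]
    linarith
  have h3 := h1.trans (mul_le_mul_of_nonneg_left h2 hr.le)
  rw [mul_div_assoc', le_div_iff₀ hK, mul_comm r] at h3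
  exact le_of_mul_le_mul_left h3 (by positivity)

theorem sq_coeff_div_coeff_le (h : IsOrthonormalFor L P)
    (hpos : ∀ p : ℝ[X], (∀ x, 0 ≤ p.eval x) → 0 ≤ L p) (n : ℕ) :
    ((P n).coeff n / (P (n + 1)).coeff (n + 1)) ^ 2 ≤ L (X ^ 2 * P (n + 1) ^ 2) := by
  have h1 := h.map_X_mul_mul n
  set r := (P n).coeff n / (P (n + 1)).coeff (n + 1)
  have h2 := hpos ((X * P (n + 1) - C r * P n) ^ 2) fun x => by
    rw [eval_pow]
    positivity
  have e : (X * P (n + 1) - C r * P n) ^ 2 = X ^ 2 * P (n + 1) ^ 2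
      - (2 * r) • (X * P n * P (n + 1)) + (r ^ 2) • P n ^ 2 := by
    simp only [smul_eq_C_mul, map_mul, map_pow, map_ofNat]
    ring
  rw [e] at h2
  simp only [map_add, map_sub, map_smul, h.map_sq, h1, smul_eq_mul] at h2
  linarith

/-- Chebyshev's correlation inequality for the even moments of `P n ^ 2`. -/
theorem mul_map_X_pow_le (h : IsOrthonormalFor L P)
    (hpos : ∀ p : ℝ[X], (∀ x, 0 ≤ p.eval x) → 0 ≤ L p) {n : ℕ} {K : ℝ} (hK : 0 ≤ K)
    (hK' : K ≤ L (X ^ 2 * P n ^ 2)) (j : ℕ) :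
    K * L (X ^ (2 * j) * P n ^ 2) ≤ L (X ^ (2 * (j + 1)) * P n ^ 2) := by
  have h1 := hpos ((X ^ 2 - C K) * (X ^ (2 * j) - C (K ^ j)) * P n ^ 2) fun x => by
    simp only [eval_mul, eval_sub, eval_pow, eval_X, eval_C, pow_mul]
    refine mul_nonneg ?_ (sq_nonneg _)
    rcases le_total K (x ^ 2) with hx | hx
    · exact mul_nonneg (sub_nonneg.mpr hx) (sub_nonneg.mpr (pow_le_pow_left₀ hK hx j))
    · exact mul_nonneg_of_nonpos_of_nonpos (sub_nonpos.mpr hx)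
        (sub_nonpos.mpr (pow_le_pow_left₀ (sq_nonneg x) hx j))
  have e : (X ^ 2 - C K) * (X ^ (2 * j) - C (K ^ j)) * P n ^ 2
      = X ^ (2 * (j + 1)) * P n ^ 2 - K • (X ^ (2 * j) * P n ^ 2)
        - (K ^ j) • (X ^ 2 * P n ^ 2) + (K ^ j * K) • P n ^ 2 := by
    simp only [smul_eq_C_mul, map_mul]
    ring
  rw [e] at h1
  simp only [map_add, map_sub, map_smul, h.map_sq, smul_eq_mul] at h1
  nlinarith [mul_le_mul_of_nonneg_left hK' (pow_nonneg hK j)]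

end IsOrthonormalFor

/-- If a sequence grows at least geometrically with a large ratio, then its convolutions with
finitely many coefficients inherit the sign of the last coefficient. -/
theorem sum_Ico_mul_pos_of_geometric_growth {M β : ℕ → ℝ} {K : ℝ} {d : ℕ} (hM : M 0 = 1)
    (hK : 1 ≤ K) (hgrow : ∀ j, K * M j ≤ M (j + 1))
    (hβ : ∑ k ∈ Finset.range d, |β k| < K * β d) {l : ℕ} (hl : l ≤ d) :
    0 < ∑ k ∈ Finset.Ico l (d + 1), β k * M (k - l) := by
  have hpos : ∀ j, 0 < M j := by
    intro j
    induction j with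
    | zero => simp [hM]
    | succ j ih => exact (mul_pos (by linarith) ih).trans_le (hgrow j)
  have hmono : Monotone M := monotone_nat_of_le_succ fun j =>
    (le_mul_of_one_le_left (hpos j).le hK).trans (hgrow j)
  rw [Finset.sum_Ico_succ_top hl]
  have h1 : -((∑ k ∈ Finset.range d, |β k|) * M (d - l))
      ≤ K * ∑ k ∈ Finset.Ico l d, β k * M (k - l) := by
    calc -((∑ k ∈ Finset.range d, |β k|) * M (d - l))
        ≤ -((∑ k ∈ Finset.Ico l d, |β k|) * M (d - l)) := by
          refine neg_le_neg (mul_le_mul_of_nonneg_right ?_ (hpos _).le)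
          refine Finset.sum_le_sum_of_subset_of_nonneg ?_ fun _ _ _ => abs_nonneg _
          rw [Finset.range_eq_Ico]
          exact Finset.Ico_subset_Ico_left (Nat.zero_le l)
      _ ≤ K * ∑ k ∈ Finset.Ico l d, β k * M (k - l) := by
          rw [Finset.sum_mul, ← Finset.sum_neg_distrib, Finset.mul_sum]
          refine Finset.sum_le_sum fun k hk => ?_
          obtain ⟨hlk, hkd⟩ := Finset.mem_Ico.mp hk
          have h2 : K * M (k - l) ≤ M (d - l) := (hgrow _).trans (hmono (by omega))
          have h3 := mul_le_mul_of_nonneg_left h2 (abs_nonneg (β k))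
          have h4 := mul_le_mul_of_nonneg_right (neg_abs_le (β k))
            (mul_nonneg (zero_le_one.trans hK) (hpos (k - l)).le)
          linarith
  have h5 := mul_lt_mul_of_pos_right hβ (hpos (d - l))
  exact pos_of_mul_pos_right (a := K) (by linarith) (by linarith)

/-- An even polynomial of degree at least two with positive leading coefficient. -/
structure IsEvenConfining (φ : ℝ[X]) : Prop where
  comp_neg_X : φ.comp (-X) = φ
  two_le_natDegree : 2 ≤ φ.natDegree
  leadingCoeff_pos : 0 < φ.leadingCoeff

namespace IsEvenConfining

variable {φ : ℝ[X]}

theorem eval_neg (h : IsEvenConfining φ) (x : ℝ) : φ.eval (-x) = φ.eval x := by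
  conv_rhs => rw [← h.comp_neg_X]
  simp

theorem derivative_eval_neg (h : IsEvenConfining φ) (x : ℝ) :
    (derivative φ).eval (-x) = -(derivative φ).eval x := by
  have := congrArg (fun p => (derivative p).eval x) h.comp_neg_X
  simp [derivative_comp] at this
  linarith

theorem isBigO_eval_mul_exp_neg (h : IsEvenConfining φ) (p : ℝ[X]) :
    (fun x => p.eval x * Real.exp (-φ.eval x)) =O[Filter.atTop] fun x => Real.exp (-1 * x) := by
  have h1 : (fun x => p.eval x) =O[Filter.atTop] Real.exp :=
    (Asymptotics.isLittleO_of_tendsto (fun x hx => absurd hx (Real.exp_pos x).ne')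
      p.tendsto_div_exp_atTop).isBigO
  have hdeg : (C 2 * X : ℝ[X]).degree < φ.degree := by
    refine degree_lt_degree ?_
    rw [natDegree_C_mul_X _ two_ne_zero]
    exact h.two_le_natDegree
  have h2 : Filter.Tendsto (fun x => (φ - C 2 * X).eval x) Filter.atTop Filter.atTop := by
    refine tendsto_atTop_of_leadingCoeff_nonneg _ ?_ ?_
    · rw [degree_sub_eq_left_of_degree_lt hdeg]
      exact natDegree_pos_iff_degree_pos.mp (by linarith [h.two_le_natDegree])
    · rw [leadingCoeff_sub_of_degree_lt hdeg]
      exact h.leadingCoeff_pos.le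
  have h3 : (fun x => Real.exp (-φ.eval x)) =O[Filter.atTop] fun x => Real.exp (-2 * x) := by
    refine Asymptotics.IsBigO.of_bound 1 ?_
    filter_upwards [h2.eventually_ge_atTop 0] with x hx
    simp only [eval_sub, eval_mul, eval_C, eval_X] at hx
    rw [Real.norm_eq_abs, Real.norm_eq_abs, Real.abs_exp, Real.abs_exp, one_mul,
      Real.exp_le_exp]
    linarith
  refine (h1.mul h3).congr_right fun x => ?_
  rw [← Real.exp_add]
  congr 1
  ring

theorem integrable_eval_mul_exp_neg (h : IsEvenConfining φ) (p : ℝ[X]) :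
    Integrable fun x => p.eval x * Real.exp (-φ.eval x) := by
  have key : ∀ q : ℝ[X], IntegrableOn (fun x => q.eval x * Real.exp (-φ.eval x)) (Set.Ioi 0) :=
    fun q => integrable_of_isBigO_exp_neg one_pos (by fun_prop) (h.isBigO_eval_mul_exp_neg q)
  have hneg := (key (p.comp (-X))).comp_neg
  rw [← integrableOn_univ, ← Set.Iic_union_Ioi (a := (0 : ℝ)), integrableOn_union,
    integrableOn_Iic_iff_integrableOn_Iio]
  refine ⟨?_, key p⟩
  simpa [h.eval_neg] using hneg

/-- Integration of polynomials against the weight `exp (-φ)`. -/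
noncomputable def weightIntegral (h : IsEvenConfining φ) : ℝ[X] →ₗ[ℝ] ℝ where
  toFun p := ∫ x, p.eval x * Real.exp (-φ.eval x)
  map_add' p q := by
    rw [← integral_add (h.integrable_eval_mul_exp_neg p) (h.integrable_eval_mul_exp_neg q)]
    simp only [eval_add, add_mul]
  map_smul' c p := by
    rw [RingHom.id_apply, smul_eq_mul, ← integral_const_mul]
    simp only [eval_smul, smul_eq_mul, mul_assoc]

theorem weightIntegral_apply (h : IsEvenConfining φ) (p : ℝ[X]) :
    h.weightIntegral p = ∫ x, p.eval x * Real.exp (-φ.eval x) := rfl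

theorem weightIntegral_nonneg (h : IsEvenConfining φ) (p : ℝ[X]) (hp : ∀ x, 0 ≤ p.eval x) :
    0 ≤ h.weightIntegral p :=
  integral_nonneg fun x => mul_nonneg (hp x) (Real.exp_pos _).le

theorem weightIntegral_comp_neg_X (h : IsEvenConfining φ) (p : ℝ[X]) :
    h.weightIntegral (p.comp (-X)) = h.weightIntegral p := by
  rw [weightIntegral_apply, weightIntegral_apply,
    ← integral_neg_eq_self (fun x => p.eval x * Real.exp (-φ.eval x))]
  simp [h.eval_neg]

theorem weightIntegral_derivative (h : IsEvenConfining φ) (p : ℝ[X]) :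
    h.weightIntegral (derivative p) = h.weightIntegral (derivative φ * p) := by
  rw [← sub_eq_zero, ← map_sub]
  refine integral_eq_zero_of_hasDerivAt_of_integrable
    (f := fun x => p.eval x * Real.exp (-φ.eval x)) (fun x => ?_)
    (h.integrable_eval_mul_exp_neg _) (h.integrable_eval_mul_exp_neg _)
  refine ((p.hasDerivAt x).mul (φ.hasDerivAt x).neg.exp).congr_deriv ?_
  simp only [eval_sub, eval_mul, Pi.neg_apply]
  ring

theorem exists_abs_derivative_eval_le (h : IsEvenConfining φ) {ε : ℝ} (hε : 0 < ε) :
    ∃ c, ∀ y, |(derivative φ).eval y| ≤ ε * (y * (derivative φ).eval y) + c := by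
  have hd : 0 < (derivative φ).degree := by
    rw [← natDegree_pos_iff_degree_pos, natDegree_derivative]
    have := h.two_le_natDegree
    omega
  have hl : 0 ≤ (derivative φ).leadingCoeff := by
    rw [leadingCoeff_derivative]
    have := h.leadingCoeff_pos
    positivity
  have hd' := tendsto_atTop_of_leadingCoeff_nonneg _ hd hl
  have hlin : Filter.Tendsto (fun y : ℝ => ε * y) Filter.atTop Filter.atTop :=
    Filter.tendsto_id.const_mul_atTop hε
  set f : ℝ → ℝ := fun y => (derivative φ).eval y * (ε * y - 1) with hf
  have htop : Filter.Tendsto f Filter.atTop Filter.atTop :=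
    hd'.atTop_mul_atTop₀ (Filter.tendsto_atTop_add_const_right _ (-1) hlin)
  have hbot : Filter.Tendsto f Filter.atBot Filter.atTop := by
    have := hd'.atTop_mul_atTop₀ (Filter.tendsto_atTop_add_const_right _ 1 hlin)
    refine (this.comp Filter.tendsto_neg_atBot_atTop).congr fun y => ?_
    simp only [hf, Function.comp_apply, h.derivative_eval_neg]
    ring
  obtain ⟨x₀, hx₀⟩ := Continuous.exists_forall_le (f := f) (by fun_prop) (by
    rw [cocompact_eq_atBot_atTop]
    exact hbot.sup htop)
  refine ⟨-f x₀, fun y => abs_le.mpr ⟨?_, ?_⟩⟩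
  · have := hx₀ (-y)
    simp only [hf, h.derivative_eval_neg] at this ⊢
    linarith
  · have := hx₀ y
    simp only [hf] at this ⊢
    linarith

theorem derivative_eval_eq_sum (h : IsEvenConfining φ) {m : ℕ} (hm : φ.natDegree ≤ 2 * m) (x : ℝ) :
    (derivative φ).eval x
      = ∑ k ∈ Finset.range m, (derivative φ).coeff (2 * k + 1) * x ^ (2 * k + 1) := by
  have hpair : ∀ (f : ℕ → ℝ) n, ∑ i ∈ Finset.range (2 * n), f i
      = ∑ k ∈ Finset.range n, (f (2 * k) + f (2 * k + 1)) := by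
    intro f n
    induction n with
    | zero => simp
    | succ n ih => rw [Finset.sum_range_succ, ← ih, mul_add, Finset.sum_range_succ,
        Finset.sum_range_succ, add_assoc]
  have heven : ∀ k, (derivative φ).coeff (2 * k) = 0 := by
    intro k
    have h1 := congrArg (fun p => p.coeff (2 * k + 1)) h.comp_neg_X
    simp only [coeff_comp_neg_X, (odd_two_mul_add_one k).neg_one_pow] at h1
    rw [coeff_derivative, show φ.coeff (2 * k + 1) = 0 by linarith, zero_mul]
  have hdeg : (derivative φ).natDegree < 2 * m := by
    rw [natDegree_derivative]
    have := h.two_le_natDegree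
    omega
  rw [eval_eq_sum_range' hdeg, hpair]
  simp [heven]

end IsEvenConfining

/-- The polynomial `y ↦ ∑ k, β k * (x ^ (2 k + 1) - y ^ (2 k + 1)) / (x - y)`. -/
noncomputable def oddDividedDifference (β : ℕ → ℝ) (m : ℕ) (x : ℝ) : ℝ[X] :=
  ∑ k ∈ Finset.range m, ∑ i ∈ Finset.range (2 * k + 1), (β k * x ^ i) • X ^ (2 * k - i)

theorem oddDividedDifference_eval_mul (β : ℕ → ℝ) (m : ℕ) (x y : ℝ) :
    (oddDividedDifference β m x).eval y * (x - y)
      = ∑ k ∈ Finset.range m, β k * x ^ (2 * k + 1)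
        - ∑ k ∈ Finset.range m, β k * y ^ (2 * k + 1) := by
  simp only [oddDividedDifference, eval_finsetSum, eval_smul, eval_pow, eval_X, smul_eq_mul,
    Finset.sum_mul, ← Finset.sum_sub_distrib]
  refine Finset.sum_congr rfl fun k _ => ?_
  rw [← mul_sub, ← geom_sum₂_mul x y (2 * k + 1), Finset.sum_mul, Finset.mul_sum]
  refine Finset.sum_congr rfl fun i _ => ?_
  rw [Nat.add_sub_cancel]
  ring

theorem map_oddDividedDifference_mul {L : ℝ[X] →ₗ[ℝ] ℝ} {p : ℝ[X]}
    (hp : ∀ j, Odd j → L (X ^ j * p) = 0) (β : ℕ → ℝ) (m : ℕ) (x : ℝ) :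
    L (oddDividedDifference β m x * p) = ∑ l ∈ Finset.range m,
      (∑ k ∈ Finset.Ico l m, β k * L (X ^ (2 * (k - l)) * p)) * x ^ (2 * l) := by
  have hodd : ∀ (f : ℕ → ℝ) n, (∀ i ≤ 2 * n, Odd i → f i = 0) →
      ∑ i ∈ Finset.range (2 * n + 1), f i = ∑ l ∈ Finset.range (n + 1), f (2 * l) := by
    intro f n
    induction n with
    | zero => simp
    | succ n ih =>
      intro hf
      rw [Finset.sum_range_succ _ (n + 1), ← ih fun i hi => hf i (by omega), mul_add,
        Finset.sum_range_succ, Finset.sum_range_succ _ (2 * n + 1),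
        hf _ (by omega) (odd_two_mul_add_one n), add_zero, mul_one]
  simp only [oddDividedDifference, Finset.sum_mul, map_sum, smul_mul_assoc, map_smul, smul_eq_mul]
  calc _ = ∑ k ∈ Finset.range m, ∑ l ∈ Finset.range (k + 1),
        β k * L (X ^ (2 * (k - l)) * p) * x ^ (2 * l) := by
        refine Finset.sum_congr rfl fun k _ => ?_
        rw [hodd _ k fun i hi hi' => by rw [hp _ (Nat.Even.sub_odd hi (even_two_mul k) hi'),
          mul_zero]]
        refine Finset.sum_congr rfl fun l _ => ?_
        rw [Nat.mul_sub]
        ring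
    _ = _ := by
        refine Finset.sum_comm' fun k l => ?_
        simp only [Finset.mem_range, Finset.mem_Ico]
        omega

theorem stmt5 (m : ℕ) (hm : 1 ≤ m) (φ : Polynomial ℝ)
    (hφdeg : φ.natDegree = 2 * m) (hφlead : 0 < φ.leadingCoeff)
    (hφeven : ∀ x : ℝ, φ.eval (-x) = φ.eval x)
    (ρ : ℝ → ℝ) (hρ : ∀ x : ℝ, ρ x = Real.exp (-φ.eval x))
    (P : ℕ → Polynomial ℝ)
    (hPdeg : ∀ n, (P n).natDegree = n)
    (hPlead : ∀ n, 0 < (P n).leadingCoeff)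
    (hPorth : ∀ i j, (∫ x : ℝ, (P i).eval x * (P j).eval x * ρ x)
        = if i = j then (1 : ℝ) else 0)
    (a : ℕ → ℝ) (ha0 : a 0 = Real.sqrt (∫ x : ℝ, ρ x))
    (haS : ∀ n, 1 ≤ n → a n = ∫ x : ℝ, x * (P (n - 1)).eval x * (P n).eval x * ρ x)
    (D : ℝ → ℝ → ℝ)
    (hD : ∀ x y : ℝ, D x y * (x - y)
        = (Polynomial.derivative φ).eval x - (Polynomial.derivative φ).eval y)
    (A : ℕ → ℝ → ℝ)
    (hA : ∀ n, ∀ x : ℝ, A n x = a n * ∫ y : ℝ, D x y * (P n).eval y ^ 2 * ρ y) :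
    ∃ N₀ : ℕ, ∀ n, N₀ ≤ n →
      (∃ c : ℕ → ℝ, (∀ l < m, 0 < c l) ∧
        ∀ x : ℝ, A n x = ∑ l ∈ Finset.range m, c l * x ^ (2 * l)) ∧
      (∀ x : ℝ, 0 < A n x) ∧
      (∀ x : ℝ, A n (-x) = A n x) ∧
      (∀ x : ℝ, A n 0 ≤ A n x) ∧
      (∀ x : ℝ, 0 < 1 / A n x ∧ 1 / A n x ≤ 1 / A n 0) := by
  have h : IsEvenConfining φ := by
    refine ⟨Polynomial.funext fun x => by simp [hφeven], by omega, hφlead⟩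
  have hL : ∀ p, h.weightIntegral p = ∫ x, p.eval x * ρ x := fun p => by
    simp only [h.weightIntegral_apply, hρ]
  have hP : IsOrthonormalFor h.weightIntegral P := by
    refine ⟨hPdeg, hPlead, fun i j => ?_⟩
    rw [hL, ← hPorth]
    simp only [eval_mul]
  set L := h.weightIntegral
  obtain ⟨d, rfl⟩ : ∃ d, m = d + 1 := ⟨m - 1, by omega⟩
  set β : ℕ → ℝ := fun k => (derivative φ).coeff (2 * k + 1) with hβ
  have hβd : 0 < β d := by
    have : φ.coeff (2 * d + 1 + 1) = φ.leadingCoeff := by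
      rw [leadingCoeff, hφdeg]
      rfl
    simp only [hβ, coeff_derivative, this]
    positivity
  have hAL : ∀ n x, A n x = a n * L (oddDividedDifference β (d + 1) x * P n ^ 2) := by
    intro n x
    rw [hA, hL]
    congr 1
    refine integral_congr_ae ?_
    filter_upwards [compl_mem_ae_iff.mpr (measure_singleton x)] with y hy
    have hxy : x - y ≠ 0 := sub_ne_zero.mpr fun hxy => hy hxy.symm
    have : D x y = (oddDividedDifference β (d + 1) x).eval y := by
      refine mul_right_cancel₀ hxy ?_
      rw [hD, oddDividedDifference_eval_mul, h.derivative_eval_eq_sum hφdeg.le,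
        h.derivative_eval_eq_sum hφdeg.le]
    rw [this, eval_mul, eval_pow]
  have hratio := hP.tendsto_coeff_div_coeff h.weightIntegral_nonneg h.weightIntegral_derivative
    fun ε hε => h.exists_abs_derivative_eval_le hε
  set K := (∑ k ∈ Finset.range d, |β k|) / β d + 1 with hK
  have hK1 : 1 ≤ K := le_add_of_nonneg_left
    (div_nonneg (Finset.sum_nonneg fun _ _ => abs_nonneg _) hβd.le)
  have hβK : ∑ k ∈ Finset.range d, |β k| < K * β d := by
    rw [hK, add_mul, div_mul_cancel₀ _ hβd.ne']
    linarith
  obtain ⟨N, hN⟩ := Filter.eventually_atTop.mp (hratio.eventually_ge_atTop K)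
  refine ⟨N + 1, fun n hn => ?_⟩
  obtain ⟨n, rfl⟩ : ∃ k, n = k + 1 := ⟨n - 1, by omega⟩
  have hKn := hN n (by omega)
  have ha : 0 < a (n + 1) := by
    have : a (n + 1) = L (X * P n * P (n + 1)) := by
      rw [haS _ (by omega), hL]
      simp
    rw [this, hP.map_X_mul_mul]
    linarith
  have hM := hP.mul_map_X_pow_le h.weightIntegral_nonneg (zero_le_one.trans hK1)
    (show K ≤ L (X ^ 2 * P (n + 1) ^ 2) from
      ((le_self_pow₀ hK1 two_ne_zero).trans (pow_le_pow_left₀ (by linarith) hKn 2)).trans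
        (hP.sq_coeff_div_coeff_le h.weightIntegral_nonneg n))
  set c : ℕ → ℝ := fun l =>
    a (n + 1) * ∑ k ∈ Finset.Ico l (d + 1), β k * L (X ^ (2 * (k - l)) * P (n + 1) ^ 2) with hc
  have hcpos : ∀ l < d + 1, 0 < c l := fun l hl => mul_pos ha <|
    sum_Ico_mul_pos_of_geometric_growth (M := fun j => L (X ^ (2 * j) * P (n + 1) ^ 2))
      (by simp [hP.map_sq]) hK1 hM hβK (by omega)
  have hAc : ∀ x, A (n + 1) x = ∑ l ∈ Finset.range (d + 1), c l * x ^ (2 * l) := by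
    intro x
    rw [hAL, map_oddDividedDifference_mul
      fun j hj => hP.map_X_pow_mul_sq_eq_zero h.weightIntegral_comp_neg_X (n + 1) hj,
      Finset.mul_sum]
    simp only [hc, mul_assoc]
  have hA0 : A (n + 1) 0 = c 0 := by
    rw [hAc, Finset.sum_range_succ']
    simp
  have hmin : ∀ x, A (n + 1) 0 ≤ A (n + 1) x := by
    intro x
    rw [hA0, hAc, Finset.sum_range_succ']
    simp only [mul_zero, pow_zero, mul_one]
    refine le_add_of_nonneg_left (Finset.sum_nonneg fun l hl => ?_)
    rw [pow_mul]
    exact mul_nonneg (hcpos _ (by simpa using hl)).le (by positivity)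
  have hA0pos : 0 < A (n + 1) 0 := hA0 ▸ hcpos 0 d.succ_pos
  have hApos : ∀ x, 0 < A (n + 1) x := fun x => hA0pos.trans_le (hmin x)
  refine ⟨⟨c, hcpos, hAc⟩, hApos, fun x => ?_, hmin, fun x => ⟨one_div_pos.mpr (hApos x), ?_⟩⟩
  · simp only [hAc, pow_mul, neg_sq]
  · exact one_div_le_one_div_of_le hA0pos (hmin x)
end
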